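/- If v₁ and v₂ are Knuth equivalent words with letters in {1,…,n}, then R ← v₁ = R ← v₂ for every rc-graph R satisfying condition (*). -/

import Mathlib

open scoped Classical

noncomputable section

namespace RCGraphs

/-- The simple transposition `s j`, interchanging `j` and `j+1`. -/
def sT (j : ℤ) : Equiv.Perm ℤ := Equiv.swap j (j + 1)

/-- The Coxeter length of a permutation of `ℤ`: the minimal length of an expression
as a product of simple transpositions. -/
def len (w : Equiv.Perm ℤ) : ℕ :=
  sInf {m : ℕ | ∃ l : List ℤ, l.length = m ∧ (l.map sT).prod = w}

/-- The permutations considered in the paper: bijections of `ℤ` fixing every `i > n`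
and fixing all sufficiently small integers. -/
def IsPermZ (n : ℤ) (w : Equiv.Perm ℤ) : Prop :=
  (∀ i : ℤ, n < i → w i = i) ∧ ∃ N : ℤ, ∀ i : ℤ, i < N → w i = i

/-- The reading order on positions `(i,k)`: rows (second coordinate) from `n` downward,
and within a row in order of increasing first coordinate. -/
def rcOrder (p q : ℤ × ℤ) : Prop :=
  q.2 < p.2 ∨ (p.2 = q.2 ∧ p.1 ≤ q.1)

instance : DecidableRel rcOrder := fun p q => by
  unfold rcOrder; infer_instance

instance : IsTrans (ℤ × ℤ) rcOrder :=
  ⟨fun a b c h₁ h₂ => by unfold rcOrder at *; omega⟩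

instance : IsAntisymm (ℤ × ℤ) rcOrder :=
  ⟨fun a b h₁ h₂ => by
    unfold rcOrder at *
    have h3 : a.1 = b.1 ∧ a.2 = b.2 := by omega
    exact Prod.ext h3.1 h3.2⟩

instance : IsTotal (ℤ × ℤ) rcOrder :=
  ⟨fun a b => by unfold rcOrder; omega⟩

/-- The permutation `w_R` associated to a finite set of positions `R`: the product of the
simple transpositions `s_{i+k-n-1}`, `(i,k) ∈ R`, in the reading order. -/
def wR (n : ℤ) (R : Finset (ℤ × ℤ)) : Equiv.Perm ℤ :=
  ((R.sort rcOrder).map fun p => sT (p.1 + p.2 - n - 1)).prod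

/-- `R` is an rc-graph: positions lie in the grid `{(i,k) : i ≤ n, k ≤ n}` and the
reading word is reduced. -/
def IsRC (n : ℤ) (R : Finset (ℤ × ℤ)) : Prop :=
  (∀ p ∈ R, p.1 ≤ n ∧ p.2 ≤ n) ∧ len (wR n R) = R.card

/-- Condition (*): `w_R(i) > w_R(i-1)` for all `i ≤ 0`; equivalently no two strands with
nonpositive labels cross. -/
def Star (n : ℤ) (R : Finset (ℤ × ℤ)) : Prop :=
  ∀ i : ℤ, i ≤ 0 → wR n R (i - 1) < wR n R i

/-- Strand labels in the wiring diagram of `R` (for diagrams all of whose crossings lie in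
rows `k ≥ 1`, as is the case under condition (*)).  `lab n R true i k` is the label of the
strand entering position `(i,k)` from the west (the strand passing above, if `(i,k)` is not
a crossing); `lab n R false i k` is the label of the strand entering from the south (the
strand passing below).  Each strand is labeled by the row where it begins. -/
def lab (n : ℤ) (R : Finset (ℤ × ℤ)) : Bool → ℤ → ℤ → ℤ
  | true, i, k =>
      if h : n ≤ i then k
      else if (i + 1, k) ∈ R then lab n R true (i + 1) k else lab n R false (i + 1) k
  | false, i, k =>
      if h : k ≤ 0 then i + k - n - 1
      else if (i, k - 1) ∈ R then lab n R false i (k - 1) else lab n R true i (k - 1)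
  termination_by b i k => ((n - i).toNat + k.toNat)
  decreasing_by
    all_goals simp_wf
    all_goals omega

/-- The label of the strand leaving position `(i,r)` northward. -/
def northLabel (n : ℤ) (R : Finset (ℤ × ℤ)) (i r : ℤ) : ℤ :=
  if (i, r) ∈ R then lab n R false i r else lab n R true i r

/-- `(i,k)` is an open space: not a crossing, the strand passing below it has a
nonpositive label and the strand passing above it has a positive label. -/
def OpenSpace (n : ℤ) (R : Finset (ℤ × ℤ)) (i k : ℤ) : Prop :=
  i ≤ n ∧ (i, k) ∉ R ∧ lab n R false i k ≤ 0 ∧ 0 < lab n R true i k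

/-- The main loop of the Bergeron--Billey insertion algorithm, recording the trace:
the list of pairs (current diagram, crossing just added).  `R` always contains the
crossing `p` that was just added. -/
def insertSteps (n : ℤ) : ℕ → Finset (ℤ × ℤ) → ℤ × ℤ → List (Finset (ℤ × ℤ) × (ℤ × ℤ))
  | 0, _, _ => []
  | fuel + 1, R, p =>
      (R, p) ::
        if IsRC n R then []
        else
          let a := lab n R true p.1 p.2
          let b := lab n R false p.1 p.2
          -- the unique other crossing of the two strands that cross at `p`
          let C := R.filter fun q =>
            q ≠ p ∧ ((lab n R true q.1 q.2 = a ∧ lab n R false q.1 q.2 = b) ∨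
                     (lab n R true q.1 q.2 = b ∧ lab n R false q.1 q.2 = a))
          let q := (C.sort rcOrder).headI
          let R' := R.erase q
          let i' := sInf {x : ℤ | q.1 < x ∧ OpenSpace n R' x q.2}
          insertSteps n fuel (insert (i', q.2) R') (i', q.2)

/-- The trace of the insertion of `k` into `R`: the states of the algorithm together with
the crossings added at each step. -/
def insertStepsOf (n : ℤ) (R : Finset (ℤ × ℤ)) (k : ℤ) : List (Finset (ℤ × ℤ) × (ℤ × ℤ)) :=
  let i₁ := sInf {x : ℤ | OpenSpace n R x k}
  insertSteps n ((n + 1 - k).toNat + 1) (insert (i₁, k) R) (i₁, k)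

/-- The insertion `R ← k` of Bergeron and Billey. -/
def insertOne (n : ℤ) (R : Finset (ℤ × ℤ)) (k : ℤ) : Finset (ℤ × ℤ) :=
  ((insertStepsOf n R k).getLast?.getD (R, (0, 0))).1

/-- The insertion `R ← v` of a word. -/
def insertWord (n : ℤ) (R : Finset (ℤ × ℤ)) (v : List ℕ) : Finset (ℤ × ℤ) :=
  v.foldl (fun S a => insertOne n S (a : ℤ)) R

/-- The column (first coordinate) at which the strand labeled `a` of the diagram `R`
leaves row `r` northward. -/
def strandCol (n : ℤ) (R : Finset (ℤ × ℤ)) (a r : ℤ) : ℤ :=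
  sSup {i : ℤ | i ≤ n ∧ northLabel n R i r = a}

/-- Given the trace `L` of an insertion, the column occupied in row `r` by the left path
(`left = true`) or the right path (`left = false`) of the insertion.  Between the rows of
the `t`-th and `(t+1)`-st added crossings, the left path is the piece `s_t` of the strand
whose label changes from `a_t` to `b_t`, and the right path is the piece `s^t` whose label
changes from `b_t` to `a_t`. -/
def pathCol (n : ℤ) (L : List (Finset (ℤ × ℤ) × (ℤ × ℤ))) (left : Bool) (r : ℤ) : ℤ :=
  match (L.filter fun e => e.2.2 ≤ r).getLast? with
  | some e => strandCol n e.1 (lab n e.1 left e.2.1 e.2.2) r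
  | none => 0

/-- A semistandard Young tableau with at most `n` rows (rows indexed `1,…,n`, row `j`
having `μ j` boxes, columns indexed from `0`), with entries in `{1,…,n}`, weakly
increasing along rows and strictly increasing down columns; entries outside the shape
are `0`. -/
structure SSYT (n : ℕ) (μ : ℕ → ℕ) where
  entry : ℕ → ℕ → ℕ
  entry_mem : ∀ j c, 1 ≤ j → j ≤ n → c < μ j → 1 ≤ entry j c ∧ entry j c ≤ n
  row_weak : ∀ j c₁ c₂, 1 ≤ j → j ≤ n → c₁ ≤ c₂ → c₂ < μ j → entry j c₁ ≤ entry j c₂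
  col_strict : ∀ j₁ j₂ c, 1 ≤ j₁ → j₁ < j₂ → j₂ ≤ n → c < μ j₂ → entry j₁ c < entry j₂ c
  outside : ∀ j c, j = 0 ∨ n < j ∨ μ j ≤ c → entry j c = 0

/-- `μ` is a partition with (at most) `n` parts `μ 1 ≥ μ 2 ≥ … ≥ μ n ≥ 0`
(and `μ j = 0` outside `1,…,n`). -/
def IsPartition (n : ℕ) (μ : ℕ → ℕ) : Prop :=
  (∀ j, 1 ≤ j → j < n → μ (j + 1) ≤ μ j) ∧ ∀ j, j = 0 ∨ n < j → μ j = 0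

/-- The reading word of a tableau: the rows read left to right, from the bottom row
to the top one. -/
def readingWord (n : ℕ) (μ : ℕ → ℕ) (Y : SSYT n μ) : List ℕ :=
  ((List.range n).reverse.map (· + 1)).flatMap fun j =>
    (List.range (μ j)).map fun c => Y.entry j c

/-- An elementary Knuth move. -/
def KnuthMove (w₁ w₂ : List ℕ) : Prop :=
  (∃ (u v : List ℕ) (x y z : ℕ), x < y ∧ y ≤ z ∧
      w₁ = u ++ y :: x :: z :: v ∧ w₂ = u ++ y :: z :: x :: v) ∨
  (∃ (u v : List ℕ) (x y z : ℕ), x ≤ y ∧ y < z ∧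
      w₁ = u ++ x :: z :: y :: v ∧ w₂ = u ++ z :: x :: y :: v)

/-- Knuth equivalence: the equivalence relation generated by elementary Knuth moves. -/
def KnuthEquiv (w₁ w₂ : List ℕ) : Prop := Relation.EqvGen KnuthMove w₁ w₂

/-- The monomial `x^R = ∏_{(i,k) ∈ R} x_k`. -/
def xR (R : Finset (ℤ × ℤ)) : MvPolynomial ℕ ℤ :=
  ∏ p ∈ R, MvPolynomial.X p.2.toNat

/-- The monomial `x^Y = ∏ x_i`, one factor for each entry `i` of `Y`. -/
def xY (n : ℕ) (μ : ℕ → ℕ) (Y : SSYT n μ) : MvPolynomial ℕ ℤ :=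
  ((readingWord n μ Y).map MvPolynomial.X).prod

/-- The Schubert polynomial `S_w = Σ_{R : w_R = w} x^R`. -/
def Schub (n : ℤ) (w : Equiv.Perm ℤ) : MvPolynomial ℕ ℤ :=
  ∑ᶠ R ∈ {R : Finset (ℤ × ℤ) | IsRC n R ∧ wR n R = w}, xR R

/-- The Schur polynomial `s_μ(x₁,…,x_n) = Σ_Y x^Y`, summing over all semistandard Young
tableaux of shape `μ` with entries in `{1,…,n}`. -/
def SchurP (n : ℕ) (μ : ℕ → ℕ) : MvPolynomial ℕ ℤ :=
  ∑ᶠ Y : SSYT n μ, xY n μ Y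

/-- The complete homogeneous symmetric polynomial
`h_m = Σ_{1 ≤ i₁ ≤ … ≤ i_m ≤ n} x_{i₁} ⋯ x_{i_m}`. -/
def hPoly (n m : ℕ) : MvPolynomial ℕ ℤ :=
  ∑ s ∈ (Finset.Icc 1 n).sym m, (s.1.map MvPolynomial.X).prod

/-- The top rc-graph `R(μ) = {(i,k) : 1 ≤ k ≤ n, n - μ_k + 1 ≤ i ≤ n}` of a partition. -/
def Rmu (n : ℕ) (μ : ℕ → ℕ) : Finset (ℤ × ℤ) :=
  (Finset.Icc 1 (n : ℤ)).biUnion fun k =>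
    (Finset.Icc ((n : ℤ) - μ k.toNat + 1) (n : ℤ)).image fun i => (i, k)



/-! ### The row model -/

/-- Data of one row: south labels, carrier labels, north labels, crossings. -/
structure St where
  f : ℕ → ℕ
  c : ℕ → ℕ
  g : ℕ → ℕ
  C : Set ℕ

/-- Validity of a row with carrier label `k`. -/
structure Row (k : ℕ) (S : St) : Prop where
  c0 : S.c 0 = k
  cm : ∀ x, x ∈ S.C → S.c (x + 1) = S.c x
  cn : ∀ x, x ∉ S.C → S.c (x + 1) = S.f x
  gm : ∀ x, x ∈ S.C → S.g x = S.f x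
  gn : ∀ x, x ∉ S.C → S.g x = S.c x
  lt : ∀ x, x ∈ S.C → S.f x < S.c x
  fin : ∃ N, ∀ x, N ≤ x → S.f x = 0 ∧ S.c x = 0 ∧ S.g x = 0 ∧ x ∉ S.C

def Jump (f : ℕ → ℕ) (p q : ℕ) : Prop :=
  p < q ∧ 0 < f p ∧ f q = 0 ∧ ∀ r, p < r → r < q → f p < f r

def app (f : ℕ → ℕ) (p q : ℕ) : ℕ → ℕ :=
  fun x => if x = p then 0 else if x = q then f p else f x

def sg (C : Set ℕ) (x : ℕ) : ℕ := if x ∈ C then x else x + 1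

lemma sg_mem {C : Set ℕ} {x : ℕ} (h : x ∈ C) : sg C x = x := by simp [sg, h]
lemma sg_not {C : Set ℕ} {x : ℕ} (h : x ∉ C) : sg C x = x + 1 := by simp [sg, h]

def Absorb (C : Set ℕ) (p q : ℕ) : Prop := q = p + 1 ∧ p ∉ C ∧ q ∈ C

def Emit (g : ℕ → ℕ) (i q : ℕ) : Prop :=
  i < q ∧ 0 < g i ∧ ∀ x, i < x → x < q → g x = 0

lemma St.ext' {S T : St} (hf : S.f = T.f) (hc : S.c = T.c) (hg : S.g = T.g) (hC : S.C = T.C) :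
    S = T := by
  cases S; cases T; simp_all

/-- carrier and north labels are determined by south labels and crossings -/
lemma Row.det {k : ℕ} {S T : St} (hS : Row k S) (hT : Row k T) (hf : S.f = T.f) (hC : S.C = T.C) :
    S = T := by
  have hc : S.c = T.c := by
    funext x
    induction x with
    | zero => rw [hS.c0, hT.c0]
    | succ x ih =>
      by_cases hx : x ∈ S.C
      · rw [hS.cm x hx, hT.cm x (hC ▸ hx), ih]
      · rw [hS.cn x hx, hT.cn x (hC ▸ hx), hf]
  refine St.ext' hf hc ?_ hC
  funext x
  by_cases hx : x ∈ S.C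
  · rw [hS.gm x hx, hT.gm x (hC ▸ hx), hf]
  · rw [hS.gn x hx, hT.gn x (hC ▸ hx), hc]

/-- crossings are determined by south and north labels -/
lemma Row.det' {k : ℕ} {S T : St} (hS : Row k S) (hT : Row k T) (hf : S.f = T.f) (hg : S.g = T.g) :
    S = T := by
  have key : ∀ x, S.c x = T.c x ∧ (x ∈ S.C ↔ x ∈ T.C) := by
    intro x
    have aux : ∀ x, S.c x = T.c x → (x ∈ S.C ↔ x ∈ T.C) := by
      intro x hx
      have h1 := congrFun hf x
      have h2 := congrFun hg x
      have a1 := hS.gm x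
      have a2 := hT.gm x
      have a3 := hS.gn x
      have a4 := hT.gn x
      have a5 := hS.lt x
      have a6 := hT.lt x
      by_cases u : x ∈ S.C <;> by_cases v : x ∈ T.C <;> simp_all
    induction x with
    | zero =>
      have : S.c 0 = T.c 0 := by rw [hS.c0, hT.c0]
      exact ⟨this, aux _ this⟩
    | succ x ih =>
      have : S.c (x + 1) = T.c (x + 1) := by
        by_cases hx : x ∈ S.C
        · rw [hS.cm x hx, hT.cm x (ih.2.1 hx), ih.1]
        · rw [hS.cn x hx, hT.cn x (fun h => hx (ih.2.2 h)), hf]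
      exact ⟨this, aux _ this⟩
  exact hS.det hT hf (Set.ext fun x => (key x).2)

lemma Row.notmem {k : ℕ} {S : St} (hS : Row k S) {x : ℕ} (h : S.c x = 0) : x ∉ S.C := by
  intro hx
  have := hS.lt x hx
  omega

/-- carriers above `f p` between `p` and `q` -/
lemma Row.carr_gt {k : ℕ} {S : St} (hS : Row k S) {p q : ℕ} (hJ : Jump S.f p q) :
    ∀ x, p < x → x ≤ q → (x ≠ p + 1 ∨ p ∈ S.C) → S.f p < S.c x := by
  obtain ⟨h1, h2, h3, h4⟩ := hJ
  intro x hpx hxq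
  induction x with
  | zero => omega
  | succ x ih =>
    intro hx
    by_cases e : x = p
    · subst e
      have : x ∈ S.C := by simpa using hx
      rw [hS.cm x this]
      exact hS.lt x this
    · by_cases hc : x ∈ S.C
      · rw [hS.cm x hc]
        have := hS.lt x hc
        have := h4 x (by omega) (by omega)
        omega
      · rw [hS.cn x hc]
        exact h4 x (by omega) (by omega)

lemma Row.noC {k : ℕ} {S : St} (hS : Row k S) {p q : ℕ} (hJ : Jump S.f p q) (hp : p ∉ S.C)
    (h : p + 1 < q) : p + 1 ∉ S.C := by
  intro hc
  have h1 := hS.lt _ hc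
  rw [hS.cn p hp] at h1
  have := hJ.2.2.2 (p + 1) (by omega) h
  omega

lemma Row.noC' {k : ℕ} {S : St} (hS : Row k S) {q : ℕ} (hq : S.f q = 0) (h : q ∉ S.C) :
    q + 1 ∉ S.C ∧ S.c (q + 1) = 0 := by
  have : S.c (q + 1) = 0 := by rw [hS.cn q h, hq]
  exact ⟨hS.notmem this, this⟩

lemma fin_of {k : ℕ} {S : St} (hS : Row k S) (M : ℕ) :
    ∃ N, M < N ∧ ∀ x, N ≤ x → S.f x = 0 ∧ S.c x = 0 ∧ S.g x = 0 ∧ x ∉ S.C := by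
  obtain ⟨N, hN⟩ := hS.fin
  exact ⟨N + M + 1, by omega, fun x hx => hN x (by omega)⟩

/-- Passing of a jump through a row. -/
lemma Row.pass {k : ℕ} {S : St} (hS : Row k S) {p q : ℕ} (hJ : Jump S.f p q)
    (hA : ¬ Absorb S.C p q) :
    (∃ c', Row k ⟨app S.f p q, c', app S.g (sg S.C p) (sg S.C q), S.C⟩) ∧
      Jump S.g (sg S.C p) (sg S.C q) := by
  have hgt := hS.carr_gt hJ
  have hnoC := hS.noC hJ
  have hnoC' := fun h => hS.noC' (q := q) hJ.2.2.1 h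
  have hJ' := hJ
  obtain ⟨h1, h2, h3, h4⟩ := hJ
  have hpq : sg S.C p < sg S.C q := by
    unfold sg
    unfold Absorb at hA
    split_ifs with u v v
    · omega
    · omega
    · have : q ≠ p + 1 := fun e => hA ⟨e, u, v⟩
      omega
    · omega
  -- value of g at the ends
  have gp : S.g (sg S.C p) = S.f p := by
    by_cases u : p ∈ S.C
    · rw [sg_mem u, hS.gm p u]
    · rw [sg_not u]
      have : p + 1 ∉ S.C := by
        by_cases e : p + 1 < q
        · exact hnoC u e
        · have e : q = p + 1 := by omega
          intro v
          exact hA ⟨e, u, e ▸ v⟩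
      rw [hS.gn _ this, hS.cn p u]
  have gq : S.g (sg S.C q) = 0 := by
    by_cases v : q ∈ S.C
    · rw [sg_mem v, hS.gm q v, h3]
    · rw [sg_not v, hS.gn _ (hnoC' v).1, (hnoC' v).2]
  refine ⟨⟨fun x => if x = p + 1 ∧ p ∉ S.C then 0 else
      if x = q + 1 ∧ q ∉ S.C then S.f p else S.c x, ?_⟩, hpq, by omega, gq, ?_⟩
  · obtain ⟨N, hN0, hN⟩ := fin_of hS (q + 1)
    refine ⟨?_, ?_, ?_, ?_, ?_, ?_, ⟨N, ?_⟩⟩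
    · simp [hS.c0]
    · intro x hx
      simp only at hx ⊢
      have hm := hS.cm x hx
      have : x = p + 1 → p ∈ S.C := by
        intro e
        by_contra u
        by_cases e' : p + 1 < q
        · exact hnoC u e' (e ▸ hx)
        · have e' : q = p + 1 := by omega
          exact hA ⟨e', u, by rw [e', ← e]; exact hx⟩
      have : x = q + 1 → q ∈ S.C := by
        intro e
        by_contra u
        exact (hnoC' u).1 (e ▸ hx)
      grind
    · intro x hx
      simp only at hx ⊢
      have hm := hS.cn x hx
      unfold app
      grind
    · intro x hx
      simp only at hx ⊢
      have hm := hS.gm x hx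
      unfold app
      unfold sg at *
      grind
    · intro x hx
      simp only at hx ⊢
      have hm := hS.gn x hx
      unfold app
      unfold sg at *
      unfold Absorb at hA
      grind
    · intro x hx
      simp only at hx ⊢
      have hm := hS.lt x hx
      have := hgt q
      unfold app
      unfold Absorb at hA
      grind
    · intro x hx
      have := hN x hx
      have : sg S.C q ≤ q + 1 := by unfold sg; split_ifs <;> omega
      unfold app
      grind
  · intro r hr1 hr2
    rw [gp]
    have e1 : p < r := by
      unfold sg at hr1; split_ifs at hr1 <;> omega
    have e2 : r ≤ q := by
      unfold sg at hr2; split_ifs at hr2 <;> omega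
    have e3 : r = q → q ∉ S.C := by
      intro e v
      rw [sg_mem v] at hr2; omega
    by_cases hr : r ∈ S.C
    · rw [hS.gm r hr]
      apply h4 r e1
      rcases Nat.lt_or_ge r q with h | h
      · exact h
      · have : r = q := by omega
        exact absurd (this ▸ hr) (e3 this)
    · rw [hS.gn r hr]
      apply hgt r e1 e2
      by_cases u : p ∈ S.C
      · exact Or.inr u
      · rw [sg_not u] at hr1
        left; omega

/-- Absorption of a jump (first half). -/
lemma Row.absorb {k : ℕ} {S : St} (hS : Row k S) {p q : ℕ} (hJ : Jump S.f p q)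
    (hA : Absorb S.C p q) :
    ∃ c', Row k ⟨app S.f p q, c', S.g, S.C \ {q}⟩ ∧ c' q = 0 := by
  obtain ⟨h1, h2, h3, h4⟩ := hJ
  obtain ⟨e, hp, hq⟩ := hA
  obtain ⟨N, hN0, hN⟩ := fin_of hS (q + 1)
  refine ⟨fun x => if x = q then 0 else S.c x, ⟨?_, ?_, ?_, ?_, ?_, ?_, ⟨N, ?_⟩⟩, by simp⟩
  · have := hS.c0
    simp; grind
  · intro x hx
    simp only [Set.mem_diff, Set.mem_singleton_iff] at hx ⊢
    have := hS.cm x hx.1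
    grind
  · intro x hx
    simp only [Set.mem_diff, Set.mem_singleton_iff] at hx ⊢
    have a1 := hS.cn x
    have a2 := hS.cn p hp
    have a3 := hS.cm q hq
    unfold app
    grind
  · intro x hx
    simp only [Set.mem_diff, Set.mem_singleton_iff] at hx ⊢
    have := hS.gm x hx.1
    unfold app
    grind
  · intro x hx
    simp only [Set.mem_diff, Set.mem_singleton_iff] at hx ⊢
    have a1 := hS.gn x
    have a3 := hS.gm q hq
    grind
  · intro x hx
    simp only [Set.mem_diff, Set.mem_singleton_iff] at hx ⊢
    have := hS.lt x hx.1
    unfold app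
    grind
  · intro x hx
    have := hN x hx
    simp only [Set.mem_diff, Set.mem_singleton_iff]
    unfold app
    grind

lemma Row.carr_prop {k : ℕ} {S : St} (hS : Row k S) {i q : ℕ} (hq : S.c q = 0)
    (hE : ∀ x, i < x → x < q → S.g x = 0) : ∀ x, i < x → x ≤ q → S.c x = 0 := by
  intro x hx hxq
  obtain ⟨d, rfl⟩ : ∃ d, q = x + d := ⟨q - x, by omega⟩
  induction d generalizing x with
  | zero => simpa using hq
  | succ d ih =>
    have h1 := ih (x + 1) (by omega) (by rw [show x + 1 + d = x + (d + 1) by omega]; exact hq)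
      (fun y a b => hE y a (by omega)) (by omega)
    have h2 := hE x hx (by omega)
    by_cases hc : x ∈ S.C
    · rw [hS.cm x hc] at h1; exact h1
    · rw [← hS.gn x hc]; exact h2

/-- Facts on an emission position. -/
lemma Row.emit_facts {k : ℕ} {S : St} (hS : Row k S) {i q : ℕ} (hq : S.c q = 0)
    (hE : Emit S.g i q) :
    i ∉ S.C ∧ S.f i = 0 ∧ 0 < S.c i ∧ S.g (i + 1) = 0 ∧ i + 1 ∉ S.C ∧ S.c (i + 1) = 0 := by
  obtain ⟨h1, h2, h3⟩ := hE
  have hp := hS.carr_prop hq h3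
  have hc := hp (i + 1) (by omega) (by omega)
  have hi : i ∉ S.C := by
    intro h
    have := hS.lt i h
    rw [hS.cm i h] at hc
    omega
  have hi1 := hS.notmem hc
  refine ⟨hi, ?_, ?_, ?_, hi1, hc⟩
  · rw [← hS.cn i hi]; exact hc
  · rw [← hS.gn i hi]; exact h2
  · rw [hS.gn _ hi1, hc]

/-- Emission. -/
lemma Row.emit {k : ℕ} {S : St} (hS : Row k S) {i q : ℕ} (hq : S.c q = 0)
    (hE : Emit S.g i q) :
    (∃ c', Row k ⟨S.f, c', app S.g i (i + 1), S.C ∪ {i}⟩) ∧ Jump S.g i (i + 1) := by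
  obtain ⟨h1, h2, h3, h4, h5, h6⟩ := hS.emit_facts hq hE
  refine ⟨⟨fun x => if x = i + 1 then S.c i else S.c x, ?_⟩, by omega, hE.2.1, h4, fun r _ _ => by omega⟩
  obtain ⟨N, hN0, hN⟩ := fin_of hS (i + 2)
  refine ⟨?_, ?_, ?_, ?_, ?_, ?_, ⟨N, ?_⟩⟩
  · simpa using hS.c0
  · intro x hx
    simp only [Set.mem_union, Set.mem_singleton_iff] at hx ⊢
    have := hS.cm x
    grind
  · intro x hx
    simp only [Set.mem_union, Set.mem_singleton_iff] at hx ⊢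
    have := hS.cn x
    grind
  · intro x hx
    simp only [Set.mem_union, Set.mem_singleton_iff] at hx ⊢
    have := hS.gm x
    unfold app
    grind
  · intro x hx
    simp only [Set.mem_union, Set.mem_singleton_iff] at hx ⊢
    have := hS.gn x
    have := hS.gn i h1
    unfold app
    grind
  · intro x hx
    simp only [Set.mem_union, Set.mem_singleton_iff] at hx ⊢
    have := hS.lt x
    grind
  · intro x hx
    have := hN x hx
    simp only [Set.mem_union, Set.mem_singleton_iff]
    unfold app
    grind

lemma Row.emit_exists {k : ℕ} {S : St} (hS : Row k S) (hk : 0 < k) {q : ℕ} (hq : S.c q = 0) :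
    ∃ i, Emit S.g i q := by
  by_contra hcon
  have hz : ∀ x, x < q → S.g x = 0 := by
    by_contra h
    push Not at h
    obtain ⟨x, hx, hg⟩ := h
    have h2 := Nat.findGreatest_spec (P := fun y => y < q ∧ S.g y ≠ 0) (n := q) (m := x) (by omega)
      ⟨hx, hg⟩
    refine hcon ⟨_, h2.1, by omega, ?_⟩
    intro y hy hyq
    by_contra hne
    exact Nat.findGreatest_is_greatest (P := fun y => y < q ∧ S.g y ≠ 0) hy (by omega) ⟨hyq, hne⟩
  have : ∀ x, x ≤ q → 0 < S.c x := by
    intro x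
    induction x with
    | zero => intro _; rw [hS.c0]; exact hk
    | succ x ih =>
      intro hx
      have h1 := ih (by omega)
      have h2 := hz x (by omega)
      by_cases hc : x ∈ S.C
      · rw [hS.cm x hc]; exact h1
      · rw [hS.gn x hc] at h2; omega
  have := this q le_rfl
  omega

/-! ### Events and steps -/

/-- An event entering a row: a start of an insertion (`st = true`) or a jump `p → q`. -/
structure Ev where
  st : Bool
  p : ℕ
  q : ℕ

def fapp (e : Ev) (f : ℕ → ℕ) : ℕ → ℕ := if e.st then f else app f e.p e.q

def okEv (S : St) (e : Ev) : Prop :=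
  (e.st = true ∧ e.q = e.p + 1 ∧ ∀ x, e.p ≤ x → S.f x = 0 ∧ S.c x = 0 ∧ S.g x = 0 ∧ x ∉ S.C) ∨
  (e.st = false ∧ Jump S.f e.p e.q)

/-- The pass alternative of a step. -/
def PassC (S S' : St) (e o : Ev) : Prop :=
  e.st = false ∧ ¬ Absorb S.C e.p e.q ∧ S'.C = S.C ∧ o = ⟨false, sg S.C e.p, sg S.C e.q⟩

/-- The emission alternative of a step. -/
def EmitC (S S' : St) (e o : Ev) : Prop :=
  (e.st = true ∨ Absorb S.C e.p e.q) ∧ ∃ i, Emit S.g i e.q ∧ S'.C = (S.C \ {e.q}) ∪ {i} ∧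
    o = ⟨false, i, i + 1⟩

structure Step (k : ℕ) (S S' : St) (e o : Ev) : Prop where
  r : Row k S
  r' : Row k S'
  ok : okEv S e
  f' : S'.f = fapp e S.f
  g' : S'.g = app S.g o.p o.q
  alt : PassC S S' e o ∨ EmitC S S' e o

lemma Step.mid {k : ℕ} {S S' : St} {e o : Ev} (h : Step k S S' e o) (hE : EmitC S S' e o) :
    ∃ c', Row k ⟨S'.f, c', S.g, S.C \ {e.q}⟩ ∧ c' e.q = 0 := by
  rcases h.ok with ⟨h1, h2, h3⟩ | ⟨h1, h2⟩
  · refine ⟨S.c, ?_, ?_⟩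
    · have : S'.f = S.f := by rw [h.f']; simp [fapp, h1]
      rw [this]
      have h4 : S.C \ {e.q} = S.C := by
        have := (h3 e.q (by omega)).2.2.2
        simp [this]
      rw [h4]
      exact h.r
    · exact (h3 e.q (by omega)).2.1
  · obtain ⟨c', a, b⟩ := h.r.absorb h2 (by simpa [h1] using hE.1)
    refine ⟨c', ?_, b⟩
    have : S'.f = app S.f e.p e.q := by rw [h.f']; simp [fapp, h1]
    rw [this]
    exact a

/-- Facts on emissions -/
lemma Step.emitF {k : ℕ} {S S' : St} {e o : Ev} (h : Step k S S' e o) (hE : EmitC S S' e o) :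
    o.p < e.q ∧ 0 < S.g o.p ∧ (∀ x, o.p < x → x < e.q → S.g x = 0) ∧ o.q = o.p + 1 ∧
    o.st = false ∧
    (∀ x, x ∈ S'.C ↔ ((x ∈ S.C ∧ x ≠ e.q) ∨ x = o.p)) ∧
    (∀ x, o.p ≤ x → x < e.q → S'.f x = 0 ∧ x ∉ S.C) ∧ S.g (o.p + 1) = 0 ∧ e.q = e.p + 1 ∧
    Jump S.g o.p o.q := by
  obtain ⟨c', hM, hc⟩ := h.mid hE
  obtain ⟨hA, i, hi, hC, rfl⟩ := hE
  have hF := hM.emit_facts hc hi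
  have hJ := (hM.emit hc hi).2
  have hp := hM.carr_prop hc hi.2.2
  simp only at *
  refine ⟨hi.1, hi.2.1, hi.2.2, trivial, trivial, ?_, ?_, hF.2.2.2.1, ?_, hJ⟩
  · intro x; rw [hC]; simp; tauto
  · intro x h1 h2
    have hx : x ∉ S.C \ {e.q} := by
      rcases Nat.lt_or_ge i x with h | h
      · exact hM.notmem (hp x h h2.le)
      · rw [show x = i by omega]; exact hF.1
    have h3 : x ∉ S.C := fun h => hx ⟨h, by simp; omega⟩
    refine ⟨?_, h3⟩
    have h4 := hM.cn x hx
    simp only at h4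
    rw [← h4]
    exact hp (x + 1) (by omega) (by omega)
  · rcases h.ok with ⟨h1, h2, h3⟩ | ⟨h1, h2⟩
    · exact h2
    · exact ((by simpa [h1] using hA : Absorb S.C e.p e.q)).1

lemma Step.jump {k : ℕ} {S S' : St} {e o : Ev} (h : Step k S S' e o) :
    o.st = false ∧ Jump S.g o.p o.q := by
  rcases h.alt with hP | hE
  · obtain ⟨h1, h2, h3, rfl⟩ := hP
    have hJ : Jump S.f e.p e.q := by simpa [okEv, h1] using h.ok
    exact ⟨rfl, (h.r.pass hJ h2).2⟩
  · have := h.emitF hE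
    exact ⟨this.2.2.2.2.1, this.2.2.2.2.2.2.2.2.2⟩

lemma Emit.uniq {g : ℕ → ℕ} {i j q : ℕ} (h : Emit g i q) (h' : Emit g j q) : i = j := by
  obtain ⟨a, b, c⟩ := h
  obtain ⟨a', b', c'⟩ := h'
  by_contra hne
  rcases Nat.lt_or_gt_of_ne hne with h | h
  · have := c j h a'; omega
  · have := c' i h a; omega

lemma Step.det {k : ℕ} {S S' S'' : St} {e o o' : Ev} (h : Step k S S' e o)
    (h' : Step k S S'' e o') : o = o' ∧ S' = S'' := by
  have key : o = o' ∧ S'.C = S''.C := by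
    rcases h.alt with hP | hE <;> rcases h'.alt with hP' | hE'
    · exact ⟨hP.2.2.2.trans hP'.2.2.2.symm, hP.2.2.1.trans hP'.2.2.1.symm⟩
    · exact absurd hE'.1 (by simp [hP.1, hP.2.1])
    · exact absurd hE.1 (by simp [hP'.1, hP'.2.1])
    · obtain ⟨_, i, hi, hC, rfl⟩ := hE
      obtain ⟨_, j, hj, hC', rfl⟩ := hE'
      have := hi.uniq hj
      subst this
      exact ⟨rfl, hC.trans hC'.symm⟩
  exact ⟨key.1, h.r'.det h'.r' (h.f'.trans h'.f'.symm) key.2⟩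

lemma app_comm {g : ℕ → ℕ} {u v s t : ℕ} (h1 : Jump g u v) (h2 : Jump (app g u v) s t)
    (h3 : Jump g s t) (h4 : Jump (app g s t) u v) :
    app (app g u v) s t = app (app g s t) u v := by
  obtain ⟨a1, b1, c1, -⟩ := h1
  obtain ⟨a2, b2, c2, -⟩ := h2
  obtain ⟨a3, b3, c3, -⟩ := h3
  obtain ⟨a4, b4, c4, -⟩ := h4
  unfold app at *
  funext x
  grind

lemma sg_le (C : Set ℕ) (x : ℕ) : sg C x ≤ x + 1 := by unfold sg; split_ifs <;> omega
lemma le_sg (C : Set ℕ) (x : ℕ) : x ≤ sg C x := by unfold sg; split_ifs <;> omega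

/-- Facts on passes -/
lemma Step.passF {k : ℕ} {S S' : St} {e o : Ev} (h : Step k S S' e o) (hP : PassC S S' e o) :
    e.st = false ∧ o.p = sg S.C e.p ∧ o.q = sg S.C e.q ∧ S'.C = S.C ∧ Jump S.f e.p e.q ∧
    ¬ Absorb S.C e.p e.q ∧ S'.f = app S.f e.p e.q ∧ o.st = false := by
  obtain ⟨h1, h2, h3, rfl⟩ := hP
  have hJ : Jump S.f e.p e.q := by simpa [okEv, h1] using h.ok
  refine ⟨h1, rfl, rfl, h3, hJ, h2, ?_, rfl⟩
  rw [h.f']; simp [fapp, h1]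

lemma sg_lt {k : ℕ} {S : St} (hS : Row k S) {x y : ℕ} (hx : S.f x = 0) (hxy : x < y) :
    sg S.C x < sg S.C y := by
  have := le_sg S.C y
  by_cases h : x ∈ S.C
  · rw [sg_mem h]; omega
  · have h2 := (hS.noC' hx h).1
    rw [sg_not h]
    rcases Nat.lt_or_ge (x + 1) y with h3 | h3
    · omega
    · have : y = x + 1 := by omega
      subst this
      rw [sg_not h2]; omega

/-- descent: `y` first, then a jump `x` with `qx < qy` -/
lemma Step.descent {k : ℕ} {S S1 S2 : St} {y x oy ox : Ev} (hy : Step k S S1 y oy)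
    (hx : Step k S1 S2 x ox) (hst : x.st = false) (hq : x.q < y.q) : ox.q < oy.q := by
  have hJx : Jump S1.f x.p x.q := by simpa [okEv, hst] using hx.ok
  have hJo := hx.jump.2
  -- destination of x is at most sg
  rcases hy.alt with hP | hE
  · obtain ⟨a1, a2, a3, a4, a5, a6, a7, -⟩ := hy.passF hP
    have h1 : sg S1.C x.q < sg S1.C y.q := sg_lt hx.r hJx.2.2.1 hq
    rw [a4] at h1
    rcases hx.alt with hP' | hE'
    · have := hx.passF hP'
      rw [this.2.2.1, a3, a4]; exact h1
    · have := hx.emitF hE'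
      have := le_sg S.C y.q
      omega
  · obtain ⟨a1, a2, a3, a4, a5, a6, a7, a8, a9, a10⟩ := hy.emitF hE
    -- x.p < i
    have hpi : x.p < oy.p := by
      by_contra h
      have := (a7 x.p (by omega) (by have := hJx.1; omega)).1
      have := hJx.2.1
      omega
    have hfi := (a7 oy.p le_rfl a1).1
    have hqi : x.q ≤ oy.p := by
      by_contra h
      have := hJx.2.2.2 oy.p hpi (by omega)
      omega
    have hiC : oy.p ∈ S1.C := (a6 _).2 (Or.inr rfl)
    rcases hx.alt with hP' | hE'
    · have := hx.passF hP'
      rw [this.2.2.1, a4]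
      rcases Nat.lt_or_ge x.q oy.p with h | h
      · have := sg_le S1.C x.q; omega
      · rw [show x.q = oy.p by omega, sg_mem hiC]; omega
    · have := hx.emitF hE'
      omega

/-- ascent -/
lemma Step.ascent {k : ℕ} {S S1 S2 : St} {x y ox oy : Ev} (hx : Step k S S1 x ox)
    (hy : Step k S1 S2 y oy) (hq : x.q < y.q) :
    ox.q < oy.q := by
  have hJ := hx.jump.2
  have hg1 : 0 < S1.g ox.q := by
    rw [hx.g']; unfold app
    have := hJ.1
    have := hJ.2.1
    rw [if_neg (by omega), if_pos rfl]; omega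
  rcases hy.alt with hP' | hE'
  · obtain ⟨a1, a2, a3, a4, a5, a6, a7, -⟩ := hy.passF hP'
    rcases hx.alt with hP | hE
    · obtain ⟨b1, b2, b3, b4, b5, b6, b7, -⟩ := hx.passF hP
      rw [b3, a3, b4]
      exact sg_lt hx.r b5.2.2.1 hq
    · have := hx.emitF hE
      have := le_sg S1.C y.q
      omega
  · obtain ⟨a1, a2, a3, a4, a5, a6, a7, a8, a9, a10⟩ := hy.emitF hE'
    have hd : ox.q < y.q := by
      rcases hx.alt with hP | hE
      · obtain ⟨b1, b2, b3, b4, b5, b6, b7, -⟩ := hx.passF hP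
        have := sg_le S.C x.q
        rcases Nat.lt_or_ge (x.q + 1) y.q with h | h
        · omega
        · have e : y.q = x.q + 1 := by omega
          by_cases hc : x.q ∈ S.C
          · rw [b3, sg_mem hc]; omega
          · exfalso
            have hn := (hx.r.noC' b5.2.2.1 hc).1
            rcases hE'.1 with hs | hs
            · have hok := hy.ok
              simp only [okEv, hs, true_and] at hok
              rcases hok with ⟨h1, h2⟩ | h
              · have := (h2 x.q (by omega)).1
                rw [b7] at this
                have := b5.2.1
                have := b5.1
                unfold app at *
                grind
              · simp at h
            · have := hs.2.2
              rw [b4, e] at this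
              exact hn this
      · have := hx.emitF hE
        omega
    by_contra hcon
    have := a3 ox.q (by omega) hd
    omega

/-! ### Commutation and the triple relation -/

lemma Emit.congr {g g' : ℕ → ℕ} {i q : ℕ} (h : Emit g i q) (hg : ∀ x, i ≤ x → x < q → g' x = g x) :
    Emit g' i q := by
  obtain ⟨a, b, c⟩ := h
  refine ⟨a, ?_, ?_⟩
  · rw [hg i le_rfl a]; exact b
  · intro x h1 h2; rw [hg x h1.le h2]; exact c x h1 h2

lemma sg_congr {C D : Set ℕ} {x : ℕ} (h : x ∈ C ↔ x ∈ D) : sg C x = sg D x := by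
  simp [sg, h]

lemma Step.emit_emit {k : ℕ} {S S' : St} {e o : Ev} (h : Step k S S' e o) (hE : EmitC S S' e o) :
    Emit S.g o.p e.q := by
  obtain ⟨a1, a2, a3, -⟩ := h.emitF hE
  exact ⟨a1, a2, a3⟩

lemma Ev.ext' {a b : Ev} (h1 : a.st = b.st) (h2 : a.p = b.p) (h3 : a.q = b.q) : a = b := by
  cases a; cases b; simp_all

lemma Step.passOf {k : ℕ} {S S' : St} {e o : Ev} (h : Step k S S' e o) (hs : e.st = false)
    (hA : ¬ Absorb S.C e.p e.q) : PassC S S' e o := by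
  rcases h.alt with h | h
  · exact h
  · exact absurd h.1 (by simp [hs, hA])

lemma Step.emitOf {k : ℕ} {S S' : St} {e o : Ev} (h : Step k S S' e o)
    (hA : e.st = true ∨ Absorb S.C e.p e.q) : EmitC S S' e o := by
  rcases h.alt with h | h
  · have h1 := h.1
    have h2 := h.2.1
    simp [h1, h2] at hA
  · exact h

/-- The exceptional case of commutation. -/
def Exc (S XZ : St) (x z ox oz ox' oz' : Ev) (i : ℕ) : Prop :=
  x.q = i ∧ i + 1 < z.q ∧ i ∉ S.C ∧ i + 1 ∉ S.C ∧ 0 < S.g i ∧ ox.st = false ∧ ox.q = i + 1 ∧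
  oz = ⟨false, i + 1, i + 2⟩ ∧ oz' = ⟨false, i, i + 1⟩ ∧
  (∀ y, i + 1 ≤ y → y < z.q → XZ.f y = 0) ∧
  (∀ y, y ∈ XZ.C ↔ ((y ∈ S.C ∧ y ≠ z.q) ∨ y = i + 1)) ∧
  XZ.g = app (app S.g ox.p (i + 1)) (i + 1) (i + 2)

lemma commute {k : ℕ} {S X XZ Z ZX : St} {x z ox oz ox' oz' : Ev}
    (hx : Step k S X x ox) (hxz : Step k X XZ z oz)
    (hz : Step k S Z z oz') (hzx : Step k Z ZX x ox')
    (hst : x.st = false) (hq : x.q < z.q) :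
    (ox = ox' ∧ oz = oz') ∨
    ∃ i, Exc S XZ x z ox oz ox' oz' i ∧
      ((ox.p < i ∧ ox' = ⟨false, ox.p, i⟩ ∧
          (∀ y, y ∈ ZX.C ↔ ((y ∈ S.C ∧ y ≠ z.q) ∨ y = i))) ∨
       (ox.p = i ∧ ∃ j, j < i ∧ ox' = ⟨false, j, j + 1⟩ ∧ 0 < S.g j ∧
          (∀ y, j < y → y < i → S.g y = 0) ∧
          (∀ y, y ∈ ZX.C ↔ ((y ∈ S.C ∧ y ≠ z.q) ∨ y = j)))) := by
  have hJx : Jump S.f x.p x.q := by simpa [okEv, hst] using hx.ok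
  have hJx' : Jump Z.f x.p x.q := by simpa [okEv, hst] using hzx.ok
  have hpz : z.st = false → x.q < z.p := by
    intro hs
    have hJz : Jump S.f z.p z.q := by simpa [okEv, hs] using hz.ok
    by_contra hcon
    have h1 := hJz.2.1
    have h2 := hJx.2.2.1
    rcases Nat.lt_or_ge z.p x.q with h | h
    · have := hJz.2.2.2 _ h hq; omega
    · have : z.p = x.q := by omega
      rw [this] at h1; omega
  have jx := hx.jump
  have jz := hz.jump
  rcases hx.alt with hP | hE
  · obtain ⟨a1, a2, a3, a4, a5, a6, a7, a8⟩ := hx.passF hP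
    by_cases hA : z.st = true ∨ Absorb S.C z.p z.q
    · -- z emits
      have hEz := hz.emitOf hA
      have hEz' := hxz.emitOf (by rw [a4]; exact hA)
      obtain ⟨b1, b2, b3, b4, b5, b6, b7, b8, b9, b10⟩ := hz.emitF hEz
      obtain ⟨c1, c2, c3, c4, c5, c6, c7, c8, c9, c10⟩ := hxz.emitF hEz'
      have hvi : ox.q ≠ oz'.p := by
        intro h
        have := jx.2.2.2.1
        rw [h] at this; omega
      have hXg := hx.g'
      rcases Nat.lt_or_ge ox.q oz'.p with hlt | hge
      · -- normal
        left
        have e1 : Emit X.g oz'.p z.q := by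
          refine (hz.emit_emit hEz).congr ?_
          intro y h1 h2
          rw [hXg]
          have := jx.2.1
          simp only [app]
          rw [if_neg (by omega), if_neg (by omega)]
        have e2 := (hxz.emit_emit hEz').uniq e1
        have hqlt : x.q < oz'.p := lt_of_le_of_lt (by rw [a3]; exact le_sg _ _) hlt
        have m1 : x.p ∈ Z.C ↔ x.p ∈ S.C := by
          rw [b6]
          have := hJx.1
          constructor
          · rintro (h | h)
            · exact h.1
            · omega
          · intro h; exact Or.inl ⟨h, by omega⟩
        have m2 : x.q ∈ Z.C ↔ x.q ∈ S.C := by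
          rw [b6]
          constructor
          · rintro (h | h)
            · exact h.1
            · omega
          · intro h; exact Or.inl ⟨h, by omega⟩
        have hP' := hzx.passOf hst (by
          unfold Absorb at a6 ⊢
          rw [m1, m2]; exact a6)
        obtain ⟨d1, d2, d3, d4, d5, d6, d7, d8⟩ := hzx.passF hP'
        refine ⟨Ev.ext' (by rw [a8, d8]) (by rw [a2, d2, sg_congr m1])
          (by rw [a3, d3, sg_congr m2]), Ev.ext' (by rw [b5, c5]) e2 (by omega)⟩
      · right
        have hgt : oz'.p < ox.q := by omega
        set i := oz'.p with hi
        have hpi : x.p < i := by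
          by_contra h
          have := (b7 x.p (by omega) (by have := hJx.1; omega)).1
          have := hJx'.2.1
          omega
        have hqi : x.q ≤ i := by
          by_contra h
          have := hJx'.2.2.2 i hpi (by omega)
          have := (b7 i le_rfl b1).1
          omega
        have hsl := sg_le S.C x.q
        have hxi : x.q = i := by omega
        have hv : ox.q = i + 1 := by omega
        have hiC : i ∉ S.C := (b7 i le_rfl b1).2
        have hi1 := (hx.r.noC' (by rw [← hxi]; exact a5.2.2.1) hiC).1
        have hlt : i + 1 < z.q := by
          by_contra hcon
          have e : z.q = i + 1 := by omega
          rcases hA with hs | hs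
          · have hok := hxz.ok
            simp only [okEv, hs, true_and] at hok
            rcases hok with ⟨h1, h2⟩ | h
            · have h3 := (h2 x.q (by omega)).1
              rw [a7] at h3
              have := a5.2.1
              have := a5.1
              unfold app at h3
              rw [if_neg (by omega), if_pos rfl] at h3
              omega
            · simp at h
          · exact hi1 (e ▸ hs.2.2)
        have hXv : 0 < X.g (i + 1) := by
          rw [hXg, ← hv]
          have := jx.2.1
          have := jx.2.2.1
          simp only [app]
          rw [if_neg (by omega), if_pos trivial]
          omega
        have e1 : Emit X.g (i + 1) z.q := by
          refine ⟨hlt, hXv, ?_⟩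
          intro y h1 h2
          rw [hXg]
          have := jx.2.1
          simp only [app]
          rw [if_neg (by omega), if_neg (by omega)]
          exact b3 y (by omega) h2
        have e2 := (hxz.emit_emit hEz').uniq e1
        have m1 : x.p ∈ Z.C ↔ x.p ∈ S.C := by
          rw [b6]
          constructor
          · rintro (h | h)
            · exact h.1
            · omega
          · intro h; exact Or.inl ⟨h, by omega⟩
        have m2 : x.q ∈ Z.C := (b6 _).2 (Or.inr hxi)
        have hpu : ox.p ≤ i := by have := jx.2.1; omega
        refine ⟨i, ⟨hxi, hlt, hiC, hi1, b2, a8, hv, Ev.ext' c5 e2 (by simp only; omega),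
          Ev.ext' b5 rfl (by simp only; omega), ?_, ?_, ?_⟩, ?_⟩
        · intro y h1 h2
          exact (c7 y (by omega) h2).1
        · intro y
          rw [c6, a4, e2]
        · rw [hxz.g', hx.g', hv, c4, e2]
        · rcases Nat.lt_or_ge ox.p i with hu | hu
          · left
            have hnA : ¬ Absorb Z.C x.p x.q := by
              rintro ⟨h1, h2, h3⟩
              rw [m1] at h2
              rw [a2, sg_not h2] at hu
              omega
            obtain ⟨d1, d2, d3, d4, d5, d6, d7, d8⟩ := hzx.passF (hzx.passOf hst hnA)
            refine ⟨hu, Ev.ext' d8 (by rw [d2, a2, sg_congr m1]) (by rw [d3, sg_mem m2, hxi]), ?_⟩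
            intro y
            rw [d4, b6]
          · right
            have hu' : ox.p = i := by omega
            have hxp : x.p ∉ S.C := by
              intro h
              rw [a2, sg_mem h] at hu
              omega
            have hA' : Absorb Z.C x.p x.q := by
              refine ⟨?_, ?_, m2⟩
              · rw [a2, sg_not hxp] at hu'
                omega
              · rw [m1]; exact hxp
            have hE' := hzx.emitOf (Or.inr hA')
            obtain ⟨d1, d2, d3, d4, d5, d6, d7, d8, d9, d10⟩ := hzx.emitF hE'
            have hZg : ∀ y, y < i → Z.g y = S.g y := by
              intro y hy
              rw [hz.g']
              simp only [app]
              rw [if_neg (by omega), if_neg (by omega)]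
            refine ⟨hu', ox'.p, by omega, Ev.ext' d5 rfl d4, ?_, ?_, ?_⟩
            · rw [← hZg _ (by omega)]; exact d2
            · intro y h1 h2
              rw [← hZg _ h2]
              exact d3 y h1 (by omega)
            · intro y
              rw [d6, b6, hxi]
              constructor
              · rintro (⟨h | h, h'⟩ | h)
                · exact Or.inl h
                · exact absurd h h'
                · exact Or.inr h
              · rintro (h | h)
                · refine Or.inl ⟨Or.inl h, ?_⟩
                  rintro rfl
                  exact hiC h.1
                · exact Or.inr h
    · -- z passes
      left
      have hzs : z.st = false := by
        cases h : z.st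
        · rfl
        · exact absurd (Or.inl h) hA
      have hnA : ¬ Absorb S.C z.p z.q := fun h => hA (Or.inr h)
      obtain ⟨b1, b2, b3, b4, b5, b6, b7, b8⟩ := hz.passF (hz.passOf hzs hnA)
      obtain ⟨c1, c2, c3, c4, c5, c6, c7, c8⟩ := hxz.passF (hxz.passOf hzs (by rw [a4]; exact hnA))
      obtain ⟨d1, d2, d3, d4, d5, d6, d7, d8⟩ := hzx.passF (hzx.passOf hst (by rw [b4]; exact a6))
      refine ⟨Ev.ext' (by rw [a8, d8]) (by rw [a2, d2, b4])
          (by rw [a3, d3, b4]), Ev.ext' (by rw [b8, c8]) (by rw [b2, c2, a4]) (by rw [b3, c3, a4])⟩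
  · -- x absorbed
    left
    have hAx : Absorb S.C x.p x.q := by simpa [hst] using hE.1
    obtain ⟨a1, a2, a3, a4, a5, a6, a7, a8, a9, a10⟩ := hx.emitF hE
    obtain ⟨hx1, hx2, hx3⟩ := hAx
    have mX : ∀ y, x.q < y → (y ∈ X.C ↔ y ∈ S.C) := by
      intro y hy
      rw [a6]
      constructor
      · rintro (h | h)
        · exact h.1
        · omega
      · intro h; exact Or.inl ⟨h, by omega⟩
    by_cases hA : z.st = true ∨ Absorb S.C z.p z.q
    · have hA' : z.st = true ∨ Absorb X.C z.p z.q := by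
        rcases hA with h | h
        · exact Or.inl h
        · by_cases hs : z.st = true
          · exact Or.inl hs
          · have := hpz (by simpa using hs)
            right
            unfold Absorb at h ⊢
            rw [mX _ this, mX _ hq]; exact h
      have hEz := hz.emitOf hA
      have hEz' := hxz.emitOf hA'
      obtain ⟨b1, b2, b3, b4, b5, b6, b7, b8, b9, b10⟩ := hz.emitF hEz
      obtain ⟨c1, c2, c3, c4, c5, c6, c7, c8, c9, c10⟩ := hxz.emitF hEz'
      have hgt : x.q < oz'.p := by
        by_contra h
        exact (b7 x.q (by omega) hq).2 hx3
      have e1 : Emit X.g oz'.p z.q := by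
        refine (hz.emit_emit hEz).congr ?_
        intro y h1 h2
        rw [hx.g']
        simp only [app]
        rw [if_neg (by omega), if_neg (by omega)]
      have e2 := (hxz.emit_emit hEz').uniq e1
      have hE' := hzx.emitOf (Or.inr (by
        refine ⟨hx1, ?_, ?_⟩
        · rw [b6]
          rintro (h | h)
          · exact hx2 h.1
          · omega
        · rw [b6]; exact Or.inl ⟨hx3, by omega⟩))
      obtain ⟨d1, d2, d3, d4, d5, d6, d7, d8, d9, d10⟩ := hzx.emitF hE'
      have e3 : Emit Z.g ox.p x.q := by
        refine (hx.emit_emit hE).congr ?_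
        intro y h1 h2
        rw [hz.g']
        simp only [app]
        rw [if_neg (by omega), if_neg (by omega)]
      have e4 := (hzx.emit_emit hE').uniq e3
      exact ⟨Ev.ext' (by rw [a5, d5]) e4.symm (by omega), Ev.ext' (by rw [b5, c5]) e2 (by omega)⟩
    · have hzs : z.st = false := by
        cases h : z.st
        · rfl
        · exact absurd (Or.inl h) hA
      have hnA : ¬ Absorb S.C z.p z.q := fun h => hA (Or.inr h)
      have hp := hpz hzs
      obtain ⟨b1, b2, b3, b4, b5, b6, b7, b8⟩ := hz.passF (hz.passOf hzs hnA)
      obtain ⟨c1, c2, c3, c4, c5, c6, c7, c8⟩ := hxz.passF (hxz.passOf hzs (by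
        unfold Absorb at hnA ⊢; rw [mX _ hp, mX _ hq]; exact hnA))
      have hE' := hzx.emitOf (Or.inr (by rw [b4]; exact ⟨hx1, hx2, hx3⟩))
      obtain ⟨d1, d2, d3, d4, d5, d6, d7, d8, d9, d10⟩ := hzx.emitF hE'
      have e3 : Emit Z.g ox.p x.q := by
        refine (hx.emit_emit hE).congr ?_
        intro y h1 h2
        rw [hz.g']
        have := le_sg S.C z.p
        have := le_sg S.C z.q
        simp only [app]
        rw [if_neg (by omega), if_neg (by omega)]
      have e4 := (hzx.emit_emit hE').uniq e3
      exact ⟨Ev.ext' (by rw [a5, d5]) e4.symm (by omega), Ev.ext' (by rw [b8, c8])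
        (by rw [b2, c2, sg_congr (mX _ hp)]) (by rw [b3, c3, sg_congr (mX _ hq)])⟩

/-- The relation between triples of events. -/
inductive Rel : Ev → Ev → Ev → Ev → Ev → Ev → Prop
  | A1 (x y z : Ev) (hx : x.st = false) (h1 : x.q < y.q) (h2 : y.q < z.q) : Rel y x z y z x
  | A2 (x y z : Ev) (hx : x.st = false) (hy : y.st = false) (h1 : x.q < y.q) (h2 : y.q < z.q) :
      Rel z x y x z y
  | B (p q r q' : ℕ) (h : q < q') : Rel ⟨false, p, q⟩ ⟨false, r, p⟩ ⟨false, p, q'⟩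
      ⟨false, r, q⟩ ⟨false, q, q'⟩ ⟨false, p, q⟩

def okf (f : ℕ → ℕ) (e : Ev) : Prop := e.st = true ∨ Jump f e.p e.q

lemma fapp_comm {f : ℕ → ℕ} {x z : Ev} (h1 : okf f x) (h2 : okf (fapp x f) z) (h3 : okf f z)
    (h4 : okf (fapp z f) x) : fapp z (fapp x f) = fapp x (fapp z f) := by
  unfold okf fapp at *
  cases hx : x.st <;> cases hz : z.st <;> simp [hx, hz] at *
  exact app_comm h1 h2 h3 h4

lemma Rel.fapp_eq {e1 e2 e3 d1 d2 d3 : Ev} (h : Rel e1 e2 e3 d1 d2 d3) {f : ℕ → ℕ}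
    (h1 : okf f e1) (h2 : okf (fapp e1 f) e2) (h3 : okf (fapp e2 (fapp e1 f)) e3)
    (k1 : okf f d1) (k2 : okf (fapp d1 f) d2) (k3 : okf (fapp d2 (fapp d1 f)) d3) :
    fapp e3 (fapp e2 (fapp e1 f)) = fapp d3 (fapp d2 (fapp d1 f)) := by
  cases h with
  | A1 x y z hx a b => exact fapp_comm h2 h3 k2 k3
  | A2 x y z hx hy a b => rw [fapp_comm h1 h2 k1 k2]
  | B p q r q' hq =>
    simp only [okf, fapp, Jump, Bool.false_eq_true, false_or, if_false] at *
    funext x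
    simp only [app] at *
    grind

lemma Step.okf {k : ℕ} {S S' : St} {e o : Ev} (h : Step k S S' e o) : okf S.f e := by
  rcases h.ok with h | h
  · exact Or.inl h.1
  · exact Or.inr h.2

lemma Step.g'' {k : ℕ} {S S' : St} {e o : Ev} (h : Step k S S' e o) : S'.g = fapp o S.g := by
  rw [h.g']; simp [fapp, h.jump.1]

lemma Step.okg {k : ℕ} {S S' : St} {e o : Ev} (h : Step k S S' e o) : RCGraphs.okf S.g o :=
  Or.inr h.jump.2

lemma Step.jumpf {k : ℕ} {S S' : St} {e o : Ev} (h : Step k S S' e o) (hs : e.st = false) :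
    Jump S.f e.p e.q ∧ S'.f = app S.f e.p e.q := by
  refine ⟨by simpa [okEv, hs] using h.ok, ?_⟩
  rw [h.f']; simp [fapp, hs]

lemma rel_A1 {k : ℕ} {S S1 S2 S3 T2 T3 : St} {x y z o1 o2 o3 q2 q3 : Ev}
    (hx : x.st = false) (h1 : x.q < y.q) (h2 : y.q < z.q)
    (a1 : Step k S S1 y o1) (a2 : Step k S1 S2 x o2) (a3 : Step k S2 S3 z o3)
    (b2 : Step k S1 T2 z q2) (b3 : Step k T2 T3 x q3) : Rel o1 o2 o3 o1 q2 q3 := by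
  have l1 := a1.descent a2 hx h1
  have l2 := a1.ascent b2 h2
  rcases commute a2 a3 b2 b3 hx (by omega) with ⟨e1, e2⟩ | ⟨i, hE, -⟩
  · subst e1 e2
    exact Rel.A1 _ _ _ a2.jump.1 l1 l2
  · exfalso
    obtain ⟨-, -, -, -, -, -, c1, -, c2, -⟩ := hE
    rw [c2] at l2
    simp only at l2
    omega

lemma rel_A2 {k : ℕ} {S S1 S2 S3 T1 T2 T3 : St} {x y z o1 o2 o3 q1 q2 q3 : Ev}
    (hx : x.st = false) (hy : y.st = false) (h1 : x.q < y.q) (h2 : y.q < z.q)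
    (a1 : Step k S S1 z o1) (a2 : Step k S1 S2 x o2) (a3 : Step k S2 S3 y o3)
    (b1 : Step k S T1 x q1) (b2 : Step k T1 T2 z q2) (b3 : Step k T2 T3 y q3) :
    Rel o1 o2 o3 q1 q2 q3 := by
  rcases commute b1 b2 a1 a2 hx (by omega) with ⟨e1, e2⟩ | ⟨i, hE, hE'⟩
  · subst e1 e2
    have hS : S2 = T2 := by
      refine a2.r'.det' b2.r' ?_ ?_
      · rw [a2.f', a1.f', b2.f', b1.f']
        exact (fapp_comm b1.okf (b1.f' ▸ b2.okf) a1.okf (a1.f' ▸ a2.okf)).symm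
      · rw [a2.g'', a1.g'', b2.g'', b1.g'']
        exact (fapp_comm b1.okg (b1.g'' ▸ b2.okg) a1.okg (a1.g'' ▸ a2.okg)).symm
    subst hS
    obtain ⟨rfl, -⟩ := a3.det b3
    exact Rel.A2 _ _ _ b1.jump.1 b3.jump.1 (a2.ascent a3 h1) (b2.descent b3 hy h2)
  · obtain ⟨c1, c2, c3, c4, c5, c6, c7, c8, c9, c10, c11, c12⟩ := hE
    obtain ⟨jx, fx⟩ := b1.jumpf hx
    obtain ⟨jy, -⟩ := b3.jumpf hy
    have hyq : y.q = i + 1 := by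
      have hlt : y.p < i + 1 := by
        by_contra h
        have := c10 y.p (by omega) (by have := jy.1; omega)
        have := jy.2.1
        omega
      by_contra hne
      have := jy.2.2.2 (i + 1) hlt (by omega)
      have := c10 (i + 1) le_rfl c2
      omega
    have hT2f : ∀ w, w < i + 1 → T2.f w = app S.f x.p x.q w := by
      intro w hw
      rw [b2.f', fx]
      unfold fapp
      split_ifs with hs
      · rfl
      · have hz := (b2.jumpf (by simpa using hs)).1
        rw [fx] at hz
        have hzp : i < z.p := by
          by_contra h
          have h5 : T2.f z.q = T2.f z.q := rfl
          -- z.p ≤ i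
          have hz0 := (a1.jumpf (by simpa using hs)).1
          rcases Nat.lt_or_ge z.p i with h6 | h6
          · have h7 := hz0.2.2.2 i h6 (by omega)
            have h8 := jx.2.2.1
            rw [c1] at h8
            omega
          · have h8 := jx.2.2.1
            have h7 := hz0.2.1
            rw [show z.p = x.q by omega] at h7
            omega
        conv_lhs => rw [app]
        rw [if_neg (by omega), if_neg (by omega)]
    have hyp : y.p = i := by
      by_contra hne
      have hlt : y.p < i := by have := jy.1; omega
      have k1 := jy.2.1
      have k2 := jy.2.2.2
      rw [hT2f _ (by omega)] at k1
      have k3 := k2 i hlt (by omega)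
      rw [hT2f _ (by omega), hT2f i (by omega)] at k3
      have k4 := k2 x.p
      rw [hT2f x.p (by have := jx.1; omega)] at k4
      obtain ⟨m1, m2, m3, m4⟩ := jx
      have m5 := m4 y.p
      rw [c1] at *
      unfold app at *
      grind
    have hiT : i ∉ T2.C := by
      rw [c11]; rintro (h | h)
      · exact c3 h.1
      · omega
    have hi1T : i + 1 ∈ T2.C := by rw [c11]; exact Or.inr rfl
    have hEy := b3.emitOf (Or.inr ⟨by omega, by rw [hyp]; exact hiT, by rw [hyq]; exact hi1T⟩)
    have emy := b3.emit_emit hEy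
    obtain ⟨d1, d2, d3, d4, d5, -⟩ := b3.emitF hEy
    have jo := b1.jump.2
    rcases hE' with ⟨u1, u2, u3⟩ | ⟨u1, j, u2, u3, u4, u5, u6⟩
    · have hiS : i ∈ S2.C := by rw [u3]; exact Or.inr rfl
      have hi1S : i + 1 ∉ S2.C := by
        rw [u3]; rintro (h | h)
        · exact c4 h.1
        · omega
      obtain ⟨v1, v2, v3, v4, v5, v6, v7, v8⟩ := a3.passF (a3.passOf hy (by
        rintro ⟨w1, w2, w3⟩
        rw [hyp] at w2
        exact w2 hiS))
      have w1 : o3 = ⟨false, i, i + 2⟩ :=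
        Ev.ext' v8 (by rw [v2, hyp, sg_mem hiS]) (by rw [v3, hyq, sg_not hi1S])
      have w2 : Emit T2.g i y.q := by
        refine ⟨by omega, ?_, fun w _ _ => by omega⟩
        rw [c12]; unfold app
        rw [if_neg (by omega), if_neg (by omega), if_neg (by omega), if_neg (by omega)]
        exact c5
      have w3 := emy.uniq w2
      have w4 : q3 = ⟨false, i, i + 1⟩ := Ev.ext' d5 w3 (by rw [d4, w3])
      have w5 : q1 = ⟨false, q1.p, i + 1⟩ := Ev.ext' c6 rfl c7
      rw [w1, w4, w5, u2, c8, c9]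
      exact Rel.B i (i + 1) q1.p (i + 2) (by omega)
    · have hiS : i ∉ S2.C := by
        rw [u6]; rintro (h | h)
        · exact c3 h.1
        · omega
      have hi1S : i + 1 ∉ S2.C := by
        rw [u6]; rintro (h | h)
        · exact c4 h.1
        · omega
      obtain ⟨v1, v2, v3, v4, v5, v6, v7, v8⟩ := a3.passF (a3.passOf hy (by
        rintro ⟨w1, w2, w3⟩
        rw [hyq] at w3
        exact hi1S w3))
      have w1 : o3 = ⟨false, i + 1, i + 2⟩ :=
        Ev.ext' v8 (by rw [v2, hyp, sg_not hiS]) (by rw [v3, hyq, sg_not hi1S])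
      have w2 : Emit T2.g j y.q := by
        refine ⟨by omega, ?_, fun w h1 h2 => ?_⟩
        · rw [c12, u1]; unfold app
          rw [if_neg (by omega), if_neg (by omega), if_neg (by omega), if_neg (by omega)]
          exact u4
        · rw [c12, u1]; unfold app
          rw [if_neg (by omega), if_neg (by omega)]
          split_ifs with e e'
          · rfl
          · omega
          · exact u5 w h1 (by omega)
      have w3 := emy.uniq w2
      have w4 : q3 = ⟨false, j, j + 1⟩ := Ev.ext' d5 w3 (by rw [d4, w3])
      have w5 : q1 = ⟨false, i, i + 1⟩ := Ev.ext' c6 u1 c7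
      rw [w1, w4, w5, u3, c8, c9]
      exact Rel.A1 ⟨false, j, j + 1⟩ ⟨false, i, i + 1⟩ ⟨false, i + 1, i + 2⟩ rfl
        (by simp only; omega) (by simp only; omega)

lemma rel_B {k : ℕ} {S S1 S2 S3 T1 T2 T3 : St} {p q r q' : ℕ} {o1 o2 o3 n1 n2 n3 : Ev}
    (hqq : q < q')
    (a1 : Step k S S1 ⟨false, p, q⟩ o1) (a2 : Step k S1 S2 ⟨false, r, p⟩ o2)
    (a3 : Step k S2 S3 ⟨false, p, q'⟩ o3)
    (b1 : Step k S T1 ⟨false, r, q⟩ n1) (b2 : Step k T1 T2 ⟨false, q, q'⟩ n2)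
    (b3 : Step k T2 T3 ⟨false, p, q⟩ n3) :
    Rel o1 o2 o3 n1 n2 n3 := by
  obtain ⟨j1, f1⟩ := a1.jumpf rfl
  obtain ⟨j2, f2⟩ := a2.jumpf rfl
  obtain ⟨j3, f3⟩ := a3.jumpf rfl
  obtain ⟨i1, e1⟩ := b1.jumpf rfl
  obtain ⟨i2, e2⟩ := b2.jumpf rfl
  obtain ⟨i3, e3⟩ := b3.jumpf rfl
  simp only at *
  have hrp : r < p := j2.1
  have hpq : p < q := j1.1
  have hfrp : S.f r < S.f p := i1.2.2.2 p hrp hpq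
  have hnB1 : ¬ Absorb T1.C q q' → True := fun _ => trivial
  have hfq : S.f q = 0 := j1.2.2.1
  -- U: first passes
  obtain ⟨u1, u2, u3, u4, u5, u6, u7, u8⟩ := b1.passF (b1.passOf rfl (by
    rintro ⟨w, -, -⟩; simp only at w; omega))
  simp only at u2 u3 u4
  obtain ⟨v1, v2, v3, v4, v5, v6, v7, v8⟩ := b2.passF (b2.passOf rfl (by
    rintro ⟨w, w2, w3⟩
    simp only at w w2 w3
    rw [u4] at w2 w3
    rw [w] at w3
    exact (a1.r.noC' hfq w2).1 w3))
  simp only at v2 v3 v4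
  have hsq : sg S.C q < sg S.C q' := sg_lt a1.r hfq hqq
  have hn1 : n1 = ⟨false, sg S.C r, sg S.C q⟩ := Ev.ext' u8 u2 u3
  have hn2 : n2 = ⟨false, sg S.C q, sg S.C q'⟩ := Ev.ext' v8 (by rw [v2, u4]) (by rw [v3, u4])
  by_cases hA : Absorb S.C p q
  · obtain ⟨A1, A2, A3⟩ := hA
    have hEa := a1.emitOf (Or.inr ⟨A1, A2, A3⟩)
    have hEb := b3.emitOf (Or.inr ⟨A1, by simp only; rw [v4, u4]; exact A2,
      by simp only; rw [v4, u4]; exact A3⟩)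
    have ema := a1.emit_emit hEa
    have emb := b3.emit_emit hEb
    obtain ⟨c1, c2, c3, c4, c5, c6, c7, c8, -⟩ := a1.emitF hEa
    obtain ⟨d1, d2, d3, d4, d5, d6, d7, d8, -⟩ := b3.emitF hEb
    simp only at c6 d6 ema emb
    have hcp : 0 < S.c p := by
      by_cases h : p = r + 1 ∧ r ∉ S.C
      · rw [h.1, a1.r.cn r h.2]; exact i1.2.1
      · have := a1.r.carr_gt i1 p hrp hpq.le (by tauto)
        omega
    have hgp : 0 < S.g p := by rw [a1.r.gn p A2]; exact hcp
    have emp : Emit S.g p q := ⟨hpq, hgp, fun w _ _ => by omega⟩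
    have ho1p := ema.uniq emp
    have ho1 : o1 = ⟨false, p, q⟩ := Ev.ext' c5 ho1p (by rw [c4, ho1p, A1])
    have hsqq : sg S.C q = q := sg_mem A3
    have hpS1 : p ∈ S1.C := by rw [c6, ho1p]; exact Or.inr rfl
    have hrS1 : r ∈ S1.C ↔ r ∈ S.C := by
      rw [c6, ho1p]
      constructor
      · rintro (h | h)
        · exact h.1
        · omega
      · intro h; exact Or.inl ⟨h, by omega⟩
    have hT2g : T2.g = app (app S.g (sg S.C r) q) q (sg S.C q') := by
      rw [b2.g', b1.g', hn1, hn2, hsqq]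
    have hsq' : q' ≤ sg S.C q' := le_sg _ _
    by_cases hr : sg S.C r = p
    · have hrC : r ∉ S.C := by
        intro h; rw [sg_mem h] at hr; omega
      rw [sg_not hrC] at hr
      have hE2 := a2.emitOf (Or.inr ⟨hr.symm, by simp only; rw [hrS1]; exact hrC, hpS1⟩)
      have em2 := a2.emit_emit hE2
      obtain ⟨g1, g2, g3, g4, g5, g6, g7, g8, -⟩ := a2.emitF hE2
      simp only at em2 g6 g1
      set j := o2.p with hj
      have ho2 : o2 = ⟨false, j, j + 1⟩ := Ev.ext' g5 rfl g4
      have hS2 : ∀ w, w ∈ S2.C ↔ ((w ∈ S.C ∧ w ≠ q) ∨ w = j) := by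
        intro w
        rw [g6, c6, ho1p]
        constructor
        · rintro (⟨h | h, h'⟩ | h)
          · exact Or.inl h
          · exact absurd h h'
          · exact Or.inr h
        · rintro (h | h)
          · refine Or.inl ⟨Or.inl h, ?_⟩
            rintro rfl
            exact A2 h.1
          · exact Or.inr h
      have hpS2 : p ∉ S2.C := by
        rw [hS2]
        rintro (h | h)
        · exact A2 h.1
        · omega
      obtain ⟨x1, x2, x3, x4, x5, x6, x7, x8⟩ := a3.passF (a3.passOf rfl (by
        rintro ⟨w, w2, w3⟩
        simp only at w
        omega))
      simp only at x2 x3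
      have hq'C : q' ∈ S2.C ↔ q' ∈ S.C := by
        rw [hS2]
        constructor
        · rintro (h | h)
          · exact h.1
          · omega
        · intro h; exact Or.inl ⟨h, by omega⟩
      have ho3 : o3 = ⟨false, q, sg S.C q'⟩ := Ev.ext' x8 (by rw [x2, sg_not hpS2, A1])
        (by rw [x3, sg_congr hq'C])
      have hS1g : S1.g = app S.g p q := by rw [a1.g', ho1]
      have em3 : Emit T2.g j q := by
        refine ⟨by omega, ?_, ?_⟩
        · have := em2.2.1
          rw [hS1g] at this
          rw [hT2g, sg_not hrC, hr]
          unfold app at this ⊢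
          grind
        · intro w w1 w2
          have h3 := em2.2.2 w w1
          rw [hS1g] at h3
          rw [hT2g, sg_not hrC, hr]
          unfold app at h3 ⊢
          grind
      have hn3p := emb.uniq em3
      have hn3 : n3 = ⟨false, j, j + 1⟩ := Ev.ext' d5 hn3p (by rw [d4, hn3p])
      rw [hn3, hn1, hn2, ho1, ho2, ho3, sg_not hrC, hr, hsqq]
      exact Rel.A1 ⟨false, j, j + 1⟩ ⟨false, p, q⟩ ⟨false, q, sg S.C q'⟩ rfl
        (by simp only; omega) (by simp only; omega)
    · have hP2 := a2.passOf rfl (by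
        rintro ⟨w, w2, w3⟩
        simp only at w w2 w3
        rw [hrS1] at w2
        rw [sg_not w2] at hr
        omega)
      obtain ⟨g1, g2, g3, g4, g5, g6, g7, g8⟩ := a2.passF hP2
      simp only at g2 g3
      have ho2 : o2 = ⟨false, sg S.C r, p⟩ := Ev.ext' g8 (by rw [g2, sg_congr hrS1])
        (by rw [g3, sg_mem hpS1])
      obtain ⟨x1, x2, x3, x4, x5, x6, x7, x8⟩ := a3.passF (a3.passOf rfl (by
        rintro ⟨w, w2, w3⟩
        simp only at w
        omega))
      simp only at x2 x3
      have hq'C : q' ∈ S2.C ↔ q' ∈ S.C := by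
        rw [g4, c6, ho1p]
        constructor
        · rintro (h | h)
          · exact h.1
          · omega
        · intro h; exact Or.inl ⟨h, by omega⟩
      have ho3 : o3 = ⟨false, p, sg S.C q'⟩ := Ev.ext' x8
        (by rw [x2, sg_mem (by rw [g4]; exact hpS1)])
        (by rw [x3, sg_congr hq'C])
      have em3 : Emit T2.g p q := by
        refine ⟨hpq, ?_, fun w _ _ => by omega⟩
        rw [hT2g]
        unfold app
        rw [if_neg (by omega), if_neg (by omega), if_neg (by omega), if_neg (by omega)]
        exact hgp
      have hn3p := emb.uniq em3
      have hn3 : n3 = ⟨false, p, q⟩ := Ev.ext' d5 hn3p (by rw [d4, hn3p, A1])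
      rw [hn3, hn1, hn2, ho1, ho2, ho3, hsqq]
      exact Rel.B p q (sg S.C r) (sg S.C q') (by omega)
  · obtain ⟨c1, c2, c3, c4, -, -, -, c8⟩ := a1.passF (a1.passOf rfl hA)
    obtain ⟨d1, d2, d3, d4, -, -, -, d8⟩ := b3.passF (b3.passOf rfl (by rw [v4, u4]; exact hA))
    simp only at c2 c3 d2 d3
    obtain ⟨g1, g2, g3, g4, -, -, -, g8⟩ := a2.passF (a2.passOf rfl (by
      rintro ⟨w, w2, w3⟩
      simp only at w w2 w3
      rw [c4] at w2 w3
      have := a1.r.lt p w3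
      rw [w, a1.r.cn r w2, ← w] at this
      omega))
    simp only at g2 g3
    obtain ⟨x1, x2, x3, x4, -, -, -, x8⟩ := a3.passF (a3.passOf rfl (by
        rintro ⟨w, w2, w3⟩
        simp only at w
        omega))
    simp only at x2 x3
    have ho1 : o1 = ⟨false, sg S.C p, sg S.C q⟩ := Ev.ext' c8 c2 c3
    have ho2 : o2 = ⟨false, sg S.C r, sg S.C p⟩ := Ev.ext' g8 (by rw [g2, c4]) (by rw [g3, c4])
    have ho3 : o3 = ⟨false, sg S.C p, sg S.C q'⟩ := Ev.ext' x8 (by rw [x2, g4, c4])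
      (by rw [x3, g4, c4])
    have hn3 : n3 = ⟨false, sg S.C p, sg S.C q⟩ := Ev.ext' d8 (by rw [d2, v4, u4])
      (by rw [d3, v4, u4])
    rw [ho1, ho2, ho3, hn1, hn2, hn3]
    exact Rel.B _ _ _ _ hsq

/-- The main theorem on rows. -/
theorem row_main {k : ℕ} {S S1 S2 S3 T1 T2 T3 : St} {e1 e2 e3 d1 d2 d3 o1 o2 o3 n1 n2 n3 : Ev}
    (h : Rel e1 e2 e3 d1 d2 d3)
    (a1 : Step k S S1 e1 o1) (a2 : Step k S1 S2 e2 o2) (a3 : Step k S2 S3 e3 o3)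
    (b1 : Step k S T1 d1 n1) (b2 : Step k T1 T2 d2 n2) (b3 : Step k T2 T3 d3 n3) :
    Rel o1 o2 o3 n1 n2 n3 ∧ S3 = T3 := by
  have hR : Rel o1 o2 o3 n1 n2 n3 := by
    cases h with
    | A1 x y z hx h1 h2 =>
      obtain ⟨rfl, rfl⟩ := a1.det b1
      exact rel_A1 hx h1 h2 a1 a2 a3 b2 b3
    | A2 x y z hx hy h1 h2 => exact rel_A2 hx hy h1 h2 a1 a2 a3 b1 b2 b3
    | B p q r q' hq => exact rel_B hq a1 a2 a3 b1 b2 b3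
  refine ⟨hR, a3.r'.det' b3.r' ?_ ?_⟩
  · rw [a3.f', a2.f', a1.f', b3.f', b2.f', b1.f']
    have x2 := a2.okf
    have x3 := a3.okf
    have y2 := b2.okf
    have y3 := b3.okf
    rw [a2.f'] at x3
    rw [a1.f'] at x2 x3
    rw [b2.f'] at y3
    rw [b1.f'] at y2 y3
    exact h.fapp_eq a1.okf x2 x3 b1.okf y2 y3
  · rw [a3.g'', a2.g'', a1.g'', b3.g'', b2.g'', b1.g'']
    have x2 := a2.okg
    have x3 := a3.okg
    have y2 := b2.okg
    have y3 := b3.okg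
    rw [a2.g''] at x3
    rw [a1.g''] at x2 x3
    rw [b2.g''] at y3
    rw [b1.g''] at y2 y3
    exact hR.fapp_eq a1.okg x2 x3 b1.okg y2 y3

/-! ### Knuth relations on row sequences -/

/-- Row description of an insertion of the letter `m`. -/
structure InsR (n m : ℕ) (A A' : ℕ → St) (o : ℕ → Ev) : Prop where
  lo : ∀ k, 1 ≤ k → k ≤ n → k < m → A' k = A k
  mid : ∃ N0, ∀ N, N0 ≤ N → Step m (A m) (A' m) ⟨true, N, N + 1⟩ (o m)
  hi : ∀ k, m < k → k ≤ n → Step k (A k) (A' k) (o (k - 1)) (o k)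

lemma InsR.st {n m : ℕ} {A A' : ℕ → St} {o : ℕ → Ev} (h : InsR n m A A' o) {k : ℕ} (h1 : m ≤ k)
    (h2 : k ≤ n) : (o k).st = false := by
  rcases Nat.lt_or_ge m k with h3 | h3
  · exact (h.hi k h3 h2).jump.1
  · have : k = m := by omega
    subst this
    obtain ⟨N0, hN⟩ := h.mid
    exact (hN N0 le_rfl).jump.1

/-- two insertions of the same letter into sequences agreeing up to row `K` -/
lemma InsR.agree {n m K : ℕ} {A A' B B' : ℕ → St} {o o' : ℕ → Ev} (h : InsR n m A A' o)
    (h' : InsR n m B B' o') (hK : K ≤ n + 1) (hm : 1 ≤ m)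
    (hAB : ∀ k, 1 ≤ k → k < K → A k = B k) :
    ∀ k, 1 ≤ k → k < K → A' k = B' k ∧ (m ≤ k → o k = o' k) := by
  intro k
  induction k with
  | zero => intro h; omega
  | succ k ih =>
    intro h1 h2
    rcases Nat.lt_trichotomy (k + 1) m with h3 | h3 | h3
    · refine ⟨?_, by omega⟩
      rw [h.lo _ h1 (by omega) h3, h'.lo _ h1 (by omega) h3, hAB _ h1 h2]
    · obtain ⟨N0, hN⟩ := h.mid
      obtain ⟨N0', hN'⟩ := h'.mid
      have a := hN (N0 + N0') (by omega)
      have b := hN' (N0 + N0') (by omega)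
      rw [← h3, ← hAB _ h1 h2] at b
      rw [← h3] at a
      have := a.det b
      exact ⟨this.2, fun _ => this.1⟩
    · have hk := ih (by omega) (by omega)
      have a := h.hi _ h3 (by omega)
      have b := h'.hi _ h3 (by omega)
      rw [← hAB _ h1 h2] at b
      simp only [Nat.add_sub_cancel] at a b
      rw [← hk.2 (by omega)] at b
      have := a.det b
      exact ⟨this.2, fun _ => this.1⟩

lemma InsR.desc {n x y : ℕ} {A A1 A2 : ℕ → St} {oy ox : ℕ → Ev} (hxy : x < y)
    (hy : InsR n y A A1 oy) (hx : InsR n x A1 A2 ox) :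
    ∀ k, y ≤ k → k ≤ n → (ox k).q < (oy k).q := by
  intro k hk
  induction k, hk using Nat.le_induction with
  | base =>
    intro hn
    obtain ⟨N0, hN⟩ := hy.mid
    have a := hN (N0 + (ox (y - 1)).q) (by omega)
    have b := hx.hi y hxy hn
    exact a.descent b (hx.st (by omega) (by omega)) (by simp only; omega)
  | succ k hk ih =>
    intro hn
    have a := hy.hi (k + 1) (by omega) hn
    have b := hx.hi (k + 1) (by omega) hn
    simp only [Nat.add_sub_cancel] at a b
    exact a.descent b (hx.st (by omega) (by omega)) (ih (by omega))

lemma InsR.asc {n x y : ℕ} {A A1 A2 : ℕ → St} {oy ox : ℕ → Ev} (hxy : x ≤ y)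
    (hx : InsR n x A A1 ox) (hy : InsR n y A1 A2 oy) :
    ∀ k, y ≤ k → k ≤ n → (ox k).q < (oy k).q := by
  intro k hk
  induction k, hk using Nat.le_induction with
  | base =>
    intro hn
    obtain ⟨N0, hN⟩ := hy.mid
    rcases Nat.lt_or_ge x y with h | h
    · have a := hN (N0 + (ox (y - 1)).q) (by omega)
      have b := hx.hi y h hn
      exact b.ascent a (by simp only; omega)
    · have : x = y := by omega
      subst this
      obtain ⟨N1, hN1⟩ := hx.mid
      have a := hN (N0 + N1 + 1) (by omega)
      have b := hN1 N1 (by omega)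
      exact b.ascent a (by simp only; omega)
  | succ k hk ih =>
    intro hn
    have a := hy.hi (k + 1) (by omega) hn
    have b := hx.hi (k + 1) (by omega) hn
    simp only [Nat.add_sub_cancel] at a b
    exact b.ascent a (ih (by omega))

theorem knuth_rows1 {n x y z : ℕ} {A A1 A2 A3 B2 B3 : ℕ → St} {oy ox oz oz' ox' : ℕ → Ev}
    (hx1 : 1 ≤ x) (hxy : x < y) (hyz : y ≤ z)
    (a1 : InsR n y A A1 oy) (a2 : InsR n x A1 A2 ox) (a3 : InsR n z A2 A3 oz)
    (b2 : InsR n z A1 B2 oz') (b3 : InsR n x B2 B3 ox') (hz : z ≤ n) :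
    ∀ k, 1 ≤ k → k ≤ n → A3 k = B3 k := by
  have hAB : ∀ k, 1 ≤ k → k < z → A1 k = B2 k := fun k h1 h2 => (b2.lo k h1 (by omega) h2).symm
  have hag := a2.agree b3 (K := z) (by omega) hx1 hAB
  have hlo : ∀ k, 1 ≤ k → k < z → A3 k = B3 k := by
    intro k h1 h2
    rw [a3.lo k h1 (by omega) h2]
    exact (hag k h1 h2).1
  have hd := a1.desc hxy a2
  have hhi : ∀ k, z ≤ k → k ≤ n → Rel (oy k) (ox k) (oz k) (oy k) (oz' k) (ox' k) ∧ A3 k = B3 k := by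
    intro k hk
    induction k, hk using Nat.le_induction with
    | base =>
      intro _
      obtain ⟨N3, hN3⟩ := a3.mid
      obtain ⟨N2, hN2⟩ := b2.mid
      have p2 := a2.hi z (by omega) hz
      have p3 := b3.hi z (by omega) hz
      rw [← (hag (z - 1) (by omega) (by omega)).2 (by omega)] at p3
      rcases Nat.lt_or_ge y z with h | h
      · have p1 := a1.hi z h hz
        refine row_main (Rel.A1 (ox (z - 1)) (oy (z - 1)) ⟨true, N2 + N3 + (oy (z - 1)).q, _⟩
          (a2.st (by omega) (by omega)) (hd (z - 1) (by omega) (by omega)) (by simp only; omega))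
          p1 p2 (hN3 _ (by omega)) p1 (hN2 _ (by omega)) p3
      · have : y = z := by omega
        subst this
        obtain ⟨N1, hN1⟩ := a1.mid
        have p1 := hN1 (N1 + (ox (y - 1)).q) (by omega)
        refine row_main (Rel.A1 (ox (y - 1)) _ ⟨true, N2 + N3 + N1 + (ox (y - 1)).q + 1, _⟩
          (a2.st (by omega) (by omega)) ?_ ?_)
          p1 p2 (hN3 _ (by omega)) p1 (hN2 _ (by omega)) p3
        · simp only; omega
        · simp only; omega
    | succ k hk ih =>
      intro hn
      have p1 := a1.hi (k + 1) (by omega) hn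
      have p2 := a2.hi (k + 1) (by omega) hn
      have p3 := a3.hi (k + 1) (by omega) hn
      have q2 := b2.hi (k + 1) (by omega) hn
      have q3 := b3.hi (k + 1) (by omega) hn
      simp only [Nat.add_sub_cancel] at *
      exact row_main (ih (by omega)).1 p1 p2 p3 p1 q2 q3
  intro k h1 h2
  rcases Nat.lt_or_ge k z with h | h
  · exact hlo k h1 h
  · exact (hhi k h h2).2

theorem knuth_rows2 {n x y z : ℕ} {A A1 A2 A3 B1 B2 B3 : ℕ → St} {oy ox oz oz' ox' oy' : ℕ → Ev}
    (hx1 : 1 ≤ x) (hxy : x ≤ y) (hyz : y < z)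
    (a1 : InsR n z A A1 oz) (a2 : InsR n x A1 A2 ox) (a3 : InsR n y A2 A3 oy)
    (b1 : InsR n x A B1 ox') (b2 : InsR n z B1 B2 oz') (b3 : InsR n y B2 B3 oy') (hz : z ≤ n) :
    ∀ k, 1 ≤ k → k ≤ n → A3 k = B3 k := by
  have hAA : ∀ k, 1 ≤ k → k < z → A1 k = A k := fun k h1 h2 => a1.lo k h1 (by omega) h2
  have hag := a2.agree b1 (K := z) (by omega) hx1 hAA
  have hAB : ∀ k, 1 ≤ k → k < z → A2 k = B2 k := fun k h1 h2 => by
    rw [b2.lo k h1 (by omega) h2]; exact (hag k h1 h2).1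
  have hag' := a3.agree b3 (K := z) (by omega) (by omega) hAB
  have hlo : ∀ k, 1 ≤ k → k < z → A3 k = B3 k := fun k h1 h2 => (hag' k h1 h2).1
  have hd := a2.asc hxy a3
  have hhi : ∀ k, z ≤ k → k ≤ n → Rel (oz k) (ox k) (oy k) (ox' k) (oz' k) (oy' k) ∧ A3 k = B3 k := by
    intro k hk
    induction k, hk using Nat.le_induction with
    | base =>
      intro _
      obtain ⟨N1, hN1⟩ := a1.mid
      obtain ⟨N2, hN2⟩ := b2.mid
      have p2 := a2.hi z (by omega) hz
      have p3 := a3.hi z (by omega) hz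
      have q1 := b1.hi z (by omega) hz
      have q3 := b3.hi z (by omega) hz
      rw [← (hag (z - 1) (by omega) (by omega)).2 (by omega)] at q1
      rw [← (hag' (z - 1) (by omega) (by omega)).2 (by omega)] at q3
      refine row_main (Rel.A2 (ox (z - 1)) (oy (z - 1)) ⟨true, N1 + N2 + (oy (z - 1)).q, _⟩
          (a2.st (by omega) (by omega)) (a3.st (by omega) (by omega))
          (hd (z - 1) (by omega) (by omega)) (by simp only; omega))
          (hN1 _ (by omega)) p2 p3 q1 (hN2 _ (by omega)) q3
    | succ k hk ih =>
      intro hn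
      have p1 := a1.hi (k + 1) (by omega) hn
      have p2 := a2.hi (k + 1) (by omega) hn
      have p3 := a3.hi (k + 1) (by omega) hn
      have q1 := b1.hi (k + 1) (by omega) hn
      have q2 := b2.hi (k + 1) (by omega) hn
      have q3 := b3.hi (k + 1) (by omega) hn
      simp only [Nat.add_sub_cancel] at *
      exact row_main (ih (by omega)).1 p1 p2 p3 q1 q2 q3
  intro k h1 h2
  rcases Nat.lt_or_ge k z with h | h
  · exact hlo k h1 h
  · exact (hhi k h h2).2

/-! ### Words and permutations -/

/-- the letter at a position -/
def dl (n : ℤ) (p : ℤ × ℤ) : ℤ := p.1 + p.2 - n - 1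

/-- product of a word -/
def wp (l : List ℤ) : Equiv.Perm ℤ := (l.map sT).prod

def word (n : ℤ) (R : Finset (ℤ × ℤ)) : List ℤ := (R.sort rcOrder).map (dl n)

lemma wR_eq (n : ℤ) (R : Finset (ℤ × ℤ)) : wR n R = wp (word n R) := by
  simp [wR, wp, word, dl, List.map_map, Function.comp_def]

lemma word_length (n : ℤ) (R : Finset (ℤ × ℤ)) : (word n R).length = R.card := by
  simp [word]

lemma wp_append (l l' : List ℤ) : wp (l ++ l') = wp l * wp l' := by simp [wp]
lemma wp_cons (d : ℤ) (l : List ℤ) : wp (d :: l) = sT d * wp l := by simp [wp]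
lemma wp_nil : wp [] = 1 := rfl

lemma sT_sq (d : ℤ) : sT d * sT d = 1 := by simp [sT]
lemma sT_inv (d : ℤ) : (sT d)⁻¹ = sT d := by simp [sT]

lemma wp_reverse (l : List ℤ) : wp l.reverse = (wp l)⁻¹ := by
  induction l with
  | nil => simp [wp]
  | cons d l ih => rw [List.reverse_cons, wp_append, ih, wp_cons, wp_cons, wp_nil, mul_inv_rev, sT_inv,
      mul_one]

lemma sT_left (d : ℤ) : sT d d = d + 1 := by simp [sT]
lemma sT_right (d : ℤ) : sT d (d + 1) = d := by simp [sT]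
lemma sT_ne {d x : ℤ} (h1 : x ≠ d) (h2 : x ≠ d + 1) : sT d x = x := by
  simp [sT, Equiv.swap_apply_of_ne_of_ne h1 h2]

lemma sT_lt {d x y : ℤ} (h : x < y) (hn : ¬ (x = d ∧ y = d + 1)) : sT d x < sT d y := by
  rcases eq_or_ne x d with rfl | h1
  · have : y ≠ x + 1 := fun e => hn ⟨rfl, e⟩
    rw [sT_left, sT_ne (by omega) this]; omega
  · rcases eq_or_ne x (d + 1) with rfl | h2
    · rw [sT_right, sT_ne (by omega) (by omega)]; omega
    · rw [sT_ne h1 h2]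
      rcases eq_or_ne y d with rfl | h3
      · rw [sT_left]; omega
      · rcases eq_or_ne y (d + 1) with rfl | h4
        · rw [sT_right]; omega
        · rw [sT_ne h3 h4]; exact h

lemma exchange (l : List ℤ) : ∀ x y : ℤ, x < y → (wp l)⁻¹ y < (wp l)⁻¹ x →
    ∃ l' : List ℤ, l'.length + 1 = l.length ∧ wp l' = Equiv.swap x y * wp l := by
  induction l with
  | nil => intro x y h1 h2; simp [wp] at h2; omega
  | cons d l ih =>
    intro x y hxy h
    by_cases hn : x = d ∧ y = d + 1
    · obtain ⟨rfl, rfl⟩ := hn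
      refine ⟨l, by simp, ?_⟩
      rw [wp_cons, ← mul_assoc]
      change wp l = sT x * sT x * wp l
      rw [sT_sq, one_mul]
    · have h1 := sT_lt hxy hn
      rw [wp_cons, mul_inv_rev, sT_inv] at h
      obtain ⟨l', h2, h3⟩ := ih _ _ h1 (by simpa using h)
      refine ⟨d :: l', by simp [h2], ?_⟩
      rw [wp_cons, wp_cons, h3, ← mul_assoc, ← mul_assoc]
      congr 1
      rw [Equiv.swap_apply_apply, sT_inv, ← mul_assoc, ← mul_assoc, sT_sq, one_mul]

lemma exchange_right (l : List ℤ) (x y : ℤ) (hxy : x < y) (h : wp l y < wp l x) :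
    ∃ l' : List ℤ, l'.length + 1 = l.length ∧ wp l' = wp l * Equiv.swap x y := by
  obtain ⟨l', h1, h2⟩ := exchange l.reverse x y hxy (by rw [wp_reverse]; simpa using h)
  refine ⟨l'.reverse, by simpa using h1, ?_⟩
  rw [wp_reverse, h2, wp_reverse]; simp

lemma len_le (l : List ℤ) : len (wp l) ≤ l.length := Nat.sInf_le ⟨l, rfl, rfl⟩

lemma len_eq_of {l : List ℤ} (h : ∀ l', wp l' = wp l → l.length ≤ l'.length) :
    len (wp l) = l.length := by
  refine le_antisymm (len_le l) ?_
  obtain ⟨l', h1, h2⟩ := Nat.sInf_mem (s := {m : ℕ | ∃ l' : List ℤ, l'.length = m ∧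
    (l'.map sT).prod = wp l}) ⟨_, l, rfl, rfl⟩
  have := h l' h2
  unfold len
  omega

/-- strictly before in reading order -/
def bef (p q : ℤ × ℤ) : Prop := q.2 < p.2 ∨ (p.2 = q.2 ∧ p.1 < q.1)

lemma bef_tri {p q : ℤ × ℤ} (h : p ≠ q) : bef p q ∨ bef q p := by
  unfold bef
  have : ¬ (p.1 = q.1 ∧ p.2 = q.2) := fun h' => h (Prod.ext h'.1 h'.2)
  omega

lemma word_union {n : ℤ} {A B : Finset (ℤ × ℤ)} (h : ∀ a ∈ A, ∀ b ∈ B, bef a b) :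
    word n (A ∪ B) = word n A ++ word n B := by
  have hd : (A.sort rcOrder ++ B.sort rcOrder).Nodup := by
    rw [List.nodup_append]
    refine ⟨Finset.sort_nodup _ _, Finset.sort_nodup _ _, ?_⟩
    intro a ha b hb
    have := h a (by simpa using ha) b (by simpa using hb)
    rintro rfl
    unfold bef at this; omega
  have hp : (A.sort rcOrder ++ B.sort rcOrder).Pairwise rcOrder := by
    rw [List.pairwise_append]
    refine ⟨Finset.pairwise_sort _ _, Finset.pairwise_sort _ _, ?_⟩
    intro a ha b hb
    have := h a (by simpa using ha) b (by simpa using hb)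
    unfold bef at this; unfold rcOrder; omega
  have := (List.toFinset_sort (r := rcOrder) hd).2 hp
  rw [List.toFinset_append, Finset.sort_toFinset, Finset.sort_toFinset] at this
  unfold word
  rw [this, List.map_append]

lemma word_singleton (n : ℤ) (p : ℤ × ℤ) : word n {p} = [dl n p] := by
  simp [word]

/-- the part of `R` strictly after a cell -/
def aft (R : Finset (ℤ × ℤ)) (p : ℤ × ℤ) : Finset (ℤ × ℤ) := R.filter fun q => bef p q
def befo (R : Finset (ℤ × ℤ)) (p : ℤ × ℤ) : Finset (ℤ × ℤ) := R.filter fun q => bef q p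

lemma word_split {n : ℤ} {R : Finset (ℤ × ℤ)} {p : ℤ × ℤ} (hp : p ∈ R) :
    word n R = word n (befo R p) ++ dl n p :: word n (aft R p) := by
  have h1 : R = befo R p ∪ ({p} ∪ aft R p) := by
    ext q
    simp only [befo, aft, Finset.mem_union, Finset.mem_filter, Finset.mem_singleton]
    constructor
    · intro h
      rcases eq_or_ne q p with e | e
      · exact Or.inr (Or.inl e)
      · rcases bef_tri e with h' | h'
        · exact Or.inl ⟨h, h'⟩
        · exact Or.inr (Or.inr ⟨h, h'⟩)
    · rintro (h | rfl | h)
      · exact h.1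
      · exact hp
      · exact h.1
  conv_lhs => rw [h1]
  rw [word_union, word_union, word_singleton]
  · rfl
  · intro a ha b hb
    simp only [aft, Finset.mem_filter, Finset.mem_singleton] at ha hb
    rw [ha]; exact hb.2
  · intro a ha b hb
    simp only [befo, aft, Finset.mem_union, Finset.mem_filter, Finset.mem_singleton] at ha hb
    rcases hb with rfl | hb
    · exact ha.2
    · have := ha.2
      have := hb.2
      unfold bef at *; omega

lemma wR_split {n : ℤ} {R : Finset (ℤ × ℤ)} {p : ℤ × ℤ} (hp : p ∈ R) :
    wR n R = wR n (befo R p) * sT (dl n p) * wR n (aft R p) := by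
  rw [wR_eq, word_split hp, wp_append, wp_cons, ← wR_eq, ← wR_eq, mul_assoc]

lemma wR_union {n : ℤ} {A B : Finset (ℤ × ℤ)} (h : ∀ a ∈ A, ∀ b ∈ B, bef a b) :
    wR n (A ∪ B) = wR n A * wR n B := by
  rw [wR_eq, word_union h, wp_append, ← wR_eq, ← wR_eq]

lemma wR_fix {n : ℤ} {R : Finset (ℤ × ℤ)} {x : ℤ} (h : ∀ p ∈ R, x ≠ dl n p ∧ x ≠ dl n p + 1) :
    wR n R x = x := by
  have : ∀ l : List ℤ, (∀ d ∈ l, x ≠ d ∧ x ≠ d + 1) → wp l x = x := by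
    intro l
    induction l with
    | nil => intro _; rfl
    | cons d l ih =>
      intro hl
      rw [wp_cons, Equiv.Perm.mul_apply, ih (fun e he => hl e (List.mem_cons_of_mem _ he))]
      have := hl d (by simp)
      exact sT_ne this.1 this.2
  rw [wR_eq]
  apply this
  intro d hd
  simp only [word, List.mem_map, Finset.mem_sort] at hd
  obtain ⟨p, hp, rfl⟩ := hd
  exact h p hp

lemma wR_fix_inv {n : ℤ} {R : Finset (ℤ × ℤ)} {x : ℤ} (h : ∀ p ∈ R, x ≠ dl n p ∧ x ≠ dl n p + 1) :
    (wR n R)⁻¹ x = x := by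
  rw [Equiv.Perm.inv_eq_iff_eq]; exact (wR_fix h).symm

/-- label of the strand entering `p` from the west / south, via permutations -/
def la (n : ℤ) (R : Finset (ℤ × ℤ)) (p : ℤ × ℤ) : ℤ := (wR n (aft R p))⁻¹ (dl n p + 1)
def lb (n : ℤ) (R : Finset (ℤ × ℤ)) (p : ℤ × ℤ) : ℤ := (wR n (aft R p))⁻¹ (dl n p)

lemma IsRC.min {n : ℤ} {R : Finset (ℤ × ℤ)} (h : IsRC n R) {l : List ℤ} (hl : wp l = wR n R) :
    R.card ≤ l.length := by
  have := len_le l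
  rw [hl, h.2] at this
  exact this

lemma card_split {R : Finset (ℤ × ℤ)} {p : ℤ × ℤ} (hp : p ∈ R) :
    R.card = (befo R p).card + 1 + (aft R p).card := by
  have := congrArg List.length (word_split (n := 0) hp)
  simp only [word_length, List.length_append, List.length_cons] at this
  omega

lemma IsRC.good {n : ℤ} {R : Finset (ℤ × ℤ)} (h : IsRC n R) {p : ℤ × ℤ} (hp : p ∈ R) :
    lb n R p < la n R p := by
  by_contra hcon
  have hne : lb n R p ≠ la n R p := by
    unfold la lb
    intro e
    have := (wR n (aft R p))⁻¹.injective e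
    omega
  have hlt : la n R p < lb n R p := by omega
  unfold la lb at hlt
  rw [wR_eq] at hlt
  obtain ⟨l', h1, h2⟩ := exchange _ _ _ (by omega) hlt
  have := h.min (l := word n (befo R p) ++ l') (by
    rw [wp_append, h2, wR_split hp, wR_eq n (befo R p), wR_eq n (aft R p), mul_assoc]; rfl)
  rw [List.length_append, word_length] at this
  rw [word_length] at h1
  have := card_split hp
  omega

lemma IsRC.good_up {n : ℤ} {R : Finset (ℤ × ℤ)} (h : IsRC n R) {p : ℤ × ℤ} (hp : p ∈ R) :
    wR n R (la n R p) < wR n R (lb n R p) := by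
  have e1 : wR n R (la n R p) = wR n (befo R p) (dl n p) := by
    rw [wR_split hp]; simp [la, sT_right]
  have e2 : wR n R (lb n R p) = wR n (befo R p) (dl n p + 1) := by
    rw [wR_split hp]; simp [lb, sT_left]
  rw [e1, e2]
  by_contra hcon
  have hne : wR n (befo R p) (dl n p + 1) ≠ wR n (befo R p) (dl n p) := by
    intro e
    have := (wR n (befo R p)).injective e
    omega
  have hlt : wR n (befo R p) (dl n p + 1) < wR n (befo R p) (dl n p) := by omega
  rw [wR_eq] at hlt
  obtain ⟨l', h1, h2⟩ := exchange_right _ _ _ (by omega) hlt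
  have := h.min (l := l' ++ word n (aft R p)) (by
    rw [wp_append, h2, wR_split hp, wR_eq n (befo R p), wR_eq n (aft R p)]; rfl)
  rw [List.length_append, word_length] at this
  rw [word_length] at h1
  have := card_split hp
  omega

lemma isRC_of_good {n : ℤ} (R : Finset (ℤ × ℤ)) (hg : ∀ p ∈ R, p.1 ≤ n ∧ p.2 ≤ n)
    (h : ∀ p ∈ R, lb n R p < la n R p) : IsRC n R := by
  refine ⟨hg, ?_⟩
  have key : ∀ m : ℕ, ∀ R : Finset (ℤ × ℤ), R.card = m → (∀ p ∈ R, lb n R p < la n R p) →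
      ∀ l', wp l' = wR n R → R.card ≤ l'.length := by
    intro m
    induction m with
    | zero => intro R hR _ l' _; omega
    | succ m ih =>
      intro R hR h l' hl'
      -- the first element
      obtain ⟨p, l, hl⟩ : ∃ p l, R.sort rcOrder = p :: l := by
        cases e : R.sort rcOrder with
        | nil =>
          have := congrArg List.length e
          rw [Finset.length_sort, List.length_nil] at this
          omega
        | cons p l => exact ⟨p, l, rfl⟩
      have hpR : p ∈ R := by
        have : p ∈ R.sort rcOrder := by rw [hl]; simp
        simpa using this
      have hfirst : ∀ q ∈ R, q ≠ p → bef p q := by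
        intro q hq hne
        have hq' : q ∈ R.sort rcOrder := by simpa using hq
        have hpw := Finset.pairwise_sort R rcOrder
        rw [hl] at hq' hpw
        have h1 : rcOrder p q := (List.pairwise_cons.1 hpw).1 q (by simpa [hne] using hq')
        rcases bef_tri hne with h2 | h2
        · exfalso
          unfold bef at h2; unfold rcOrder at h1; omega
        · exact h2
      have hbe : befo R p = ∅ := by
        unfold befo
        rw [Finset.filter_eq_empty_iff]
        intro q hq hb
        rcases eq_or_ne q p with rfl | hne
        · unfold bef at hb; omega
        · have := hfirst q hq hne
          unfold bef at *; omega
      have hcard := card_split hpR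
      rw [hbe, Finset.card_empty] at hcard
      have hw : wR n R = sT (dl n p) * wR n (aft R p) := by
        rw [wR_split hpR, hbe]
        simp [wR]
      have haft : ∀ q ∈ aft R p, aft (aft R p) q = aft R q := by
        intro q hq
        have hq2 : bef p q := (Finset.mem_filter.1 hq).2
        ext s
        simp only [aft, Finset.mem_filter]
        constructor
        · rintro ⟨⟨a, b⟩, c⟩; exact ⟨a, c⟩
        · rintro ⟨a, c⟩
          refine ⟨⟨a, ?_⟩, c⟩
          unfold bef at *; omega
      have hgood := h p hpR
      have hx : (wp l')⁻¹ (dl n p + 1) < (wp l')⁻¹ (dl n p) := by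
        rw [hl', hw, mul_inv_rev, sT_inv]
        simp only [Equiv.Perm.mul_apply, sT_left, sT_right]
        exact hgood
      obtain ⟨l'', h1, h2⟩ := exchange l' _ _ (by omega) hx
      have := ih (aft R p) (by omega) (by
        intro q hq
        have := h q (Finset.mem_filter.1 hq).1
        unfold la lb at *
        rw [haft q hq]; exact this) l'' (by
          rw [h2, hl', hw, ← mul_assoc]
          change sT _ * sT _ * _ = _
          rw [sT_sq, one_mul])
      omega
  rw [wR_eq, ← word_length n R]
  apply len_eq_of
  intro l' hl'
  rw [word_length]
  exact key _ R rfl h l' (by rw [hl', wR_eq])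

/-- In an rc-graph no two strands cross twice. -/
lemma IsRC.noTwice {n : ℤ} {R : Finset (ℤ × ℤ)} (h : IsRC n R) {p q : ℤ × ℤ} (hp : p ∈ R)
    (hq : q ∈ R) (hpq : bef p q)
    (hl : (la n R p = la n R q ∧ lb n R p = lb n R q) ∨
      (la n R p = lb n R q ∧ lb n R p = la n R q)) : False := by
  have hqa : q ∈ aft R p := Finset.mem_filter.2 ⟨hq, hpq⟩
  have haa : aft (aft R p) q = aft R q := by
    ext s
    simp only [aft, Finset.mem_filter]
    constructor
    · rintro ⟨⟨a, b⟩, c⟩; exact ⟨a, c⟩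
    · rintro ⟨a, c⟩
      refine ⟨⟨a, ?_⟩, c⟩
      unfold bef at *; omega
  have hs := wR_split (n := n) hqa
  rw [haa] at hs
  set V := wR n (befo (aft R p) q) with hV
  set W := wR n (aft R q) with hW
  set d := dl n p with hd
  set e := dl n q with he
  have e1 : la n R p = W⁻¹ (sT e (V⁻¹ (d + 1))) := by
    unfold la; rw [hs]; simp [mul_inv_rev, sT_inv, ← hd]
  have e2 : lb n R p = W⁻¹ (sT e (V⁻¹ d)) := by
    unfold lb; rw [hs]; simp [mul_inv_rev, sT_inv, ← hd]
  have e3 : la n R q = W⁻¹ (e + 1) := rfl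
  have e4 : lb n R q = W⁻¹ e := rfl
  have key : V⁻¹ * sT d * V = sT e := by
    have h0 : V⁻¹ * sT d * V = Equiv.swap (V⁻¹ d) (V⁻¹ (d + 1)) := by
      rw [Equiv.swap_apply_apply]; simp [sT]
    rw [h0]
    have hcase : (V⁻¹ d = e ∧ V⁻¹ (d + 1) = e + 1) ∨ (V⁻¹ d = e + 1 ∧ V⁻¹ (d + 1) = e) := by
      rw [e1, e2, e3, e4] at hl
      have hi : ∀ x y, sT e x = y → x = sT e y := by
        intro x y hxy
        rw [← hxy, ← Equiv.Perm.mul_apply, sT_sq]; rfl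
      rcases hl with ⟨h1, h2⟩ | ⟨h1, h2⟩
      · have h1 := hi _ _ (W⁻¹.injective h1)
        have h2 := hi _ _ (W⁻¹.injective h2)
        rw [sT_right] at h1
        rw [sT_left] at h2
        exact Or.inr ⟨h2, h1⟩
      · have h1 := hi _ _ (W⁻¹.injective h1)
        have h2 := hi _ _ (W⁻¹.injective h2)
        rw [sT_left] at h1
        rw [sT_right] at h2
        exact Or.inl ⟨h2, h1⟩
    rcases hcase with ⟨h1, h2⟩ | ⟨h1, h2⟩
    · rw [h1, h2]; rfl
    · rw [h1, h2, Equiv.swap_comm]; rfl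
  have key2 : sT d * V * sT e = V := by
    rw [← key]
    have : sT d * V * (V⁻¹ * sT d * V) = sT d * sT d * V := by group
    rw [this, sT_sq, one_mul]
  have := h.min (l := word n (befo R p) ++ (word n (befo (aft R p) q) ++ word n (aft R q))) (by
    rw [wp_append, wp_append, ← wR_eq, ← wR_eq, ← wR_eq, wR_split hp, hs, ← hV, ← hW, ← hd]
    conv_lhs => rw [← key2]
    simp only [mul_assoc])
  simp only [List.length_append, word_length] at this
  have c1 := card_split hp
  have c2 := card_split hqa
  rw [haa] at c2
  omega

/-! ### Labels -/

lemma lab_true_n (n : ℤ) (R : Finset (ℤ × ℤ)) (k : ℤ) : lab n R true n k = k := by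
  rw [lab]; simp

lemma lab_true_mem {n : ℤ} {R : Finset (ℤ × ℤ)} {i k : ℤ} (hi : i < n) (h : (i + 1, k) ∈ R) :
    lab n R true i k = lab n R true (i + 1) k := by
  conv_lhs => rw [lab]
  rw [dif_neg (by omega), if_pos h]

lemma lab_true_not {n : ℤ} {R : Finset (ℤ × ℤ)} {i k : ℤ} (hi : i < n) (h : (i + 1, k) ∉ R) :
    lab n R true i k = lab n R false (i + 1) k := by
  conv_lhs => rw [lab]
  rw [dif_neg (by omega), if_neg h]

lemma lab_false_nonpos {n : ℤ} {R : Finset (ℤ × ℤ)} {i k : ℤ} (hk : k ≤ 0) :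
    lab n R false i k = i + k - n - 1 := by
  rw [lab, dif_pos hk]

lemma lab_false_mem {n : ℤ} {R : Finset (ℤ × ℤ)} {i k : ℤ} (hk : 0 < k) (h : (i, k - 1) ∈ R) :
    lab n R false i k = lab n R false i (k - 1) := by
  conv_lhs => rw [lab]
  rw [dif_neg (by omega), if_pos h]

lemma lab_false_not {n : ℤ} {R : Finset (ℤ × ℤ)} {i k : ℤ} (hk : 0 < k) (h : (i, k - 1) ∉ R) :
    lab n R false i k = lab n R true i (k - 1) := by
  conv_lhs => rw [lab]
  rw [dif_neg (by omega), if_neg h]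

lemma lab_bound (n : ℤ) (R : Finset (ℤ × ℤ)) : ∀ m : ℕ, ∀ i k : ℤ, i ≤ n →
    (n - i).toNat + k.toNat ≤ m → lab n R true i k ≤ k ∧ lab n R false i k ≤ k - 1 := by
  intro m
  induction m with
  | zero =>
    intro i k hi hm
    have : i = n := by omega
    subst this
    rw [lab_true_n, lab_false_nonpos (by omega)]
    omega
  | succ m ih =>
    intro i k hi hm
    constructor
    · rcases eq_or_lt_of_le hi with rfl | hlt
      · rw [lab_true_n]
      · have := ih (i + 1) k (by omega) (by omega)
        by_cases h : (i + 1, k) ∈ R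
        · rw [lab_true_mem hlt h]; omega
        · rw [lab_true_not hlt h]; omega
    · rcases le_or_gt k 0 with hk | hk
      · rw [lab_false_nonpos hk]; omega
      · have := ih i (k - 1) hi (by omega)
        by_cases h : (i, k - 1) ∈ R
        · rw [lab_false_mem hk h]; omega
        · rw [lab_false_not hk h]; omega

lemma aft_aft {R : Finset (ℤ × ℤ)} {P p : ℤ × ℤ} (h : bef P p) : aft (aft R P) p = aft R p := by
  ext s
  simp only [aft, Finset.mem_filter]
  constructor
  · rintro ⟨⟨a, b⟩, c⟩; exact ⟨a, c⟩
  · rintro ⟨a, c⟩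
    refine ⟨⟨a, ?_⟩, c⟩
    unfold bef at *; omega

lemma wR_cut {n : ℤ} {Q : Finset (ℤ × ℤ)} {p : ℤ × ℤ} (hp : p ∉ Q) :
    wR n Q = wR n (befo Q p) * wR n (aft Q p) := by
  rw [← wR_union]
  · congr 1
    ext q
    simp only [befo, aft, Finset.mem_union, Finset.mem_filter]
    constructor
    · intro h
      have e : q ≠ p := by rintro rfl; exact hp h
      rcases bef_tri e with h' | h'
      · exact Or.inl ⟨h, h'⟩
      · exact Or.inr ⟨h, h'⟩
    · rintro (h | h) <;> exact h.1
  · intro a ha b hb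
    have ha := (Finset.mem_filter.1 ha).2
    have hb := (Finset.mem_filter.1 hb).2
    unfold bef at *; omega

lemma cut_lab {n : ℤ} {R : Finset (ℤ × ℤ)} {P p : ℤ × ℤ} {x : ℤ} (h : bef P p)
    (hx : ∀ q ∈ R, bef P q → bef q p → x ≠ dl n q ∧ x ≠ dl n q + 1) :
    (wR n (aft R P))⁻¹ x = (wR n (aft R p))⁻¹ (if p ∈ R then sT (dl n p) x else x) := by
  have hf : (wR n (befo (aft R P) p))⁻¹ x = x := by
    apply wR_fix_inv
    intro q hq
    simp only [befo, aft, Finset.mem_filter] at hq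
    exact hx q hq.1.1 hq.1.2 hq.2
  split_ifs with hp
  · have hp' : p ∈ aft R P := Finset.mem_filter.2 ⟨hp, h⟩
    rw [wR_split hp', aft_aft h, mul_inv_rev, mul_inv_rev, sT_inv]
    simp only [Equiv.Perm.mul_apply]
    rw [hf]
  · have hp' : p ∉ aft R P := fun h => hp (Finset.mem_filter.1 h).1
    rw [wR_cut hp', aft_aft h, mul_inv_rev]
    simp only [Equiv.Perm.mul_apply]
    rw [hf]

def Grid (n : ℤ) (R : Finset (ℤ × ℤ)) : Prop := ∀ q ∈ R, q.1 ≤ n ∧ 1 ≤ q.2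

lemma lab_perm {n : ℤ} {R : Finset (ℤ × ℤ)} (hR : Grid n R) : ∀ m : ℕ, ∀ i k : ℤ, i ≤ n →
    (n - i).toNat + k.toNat ≤ m → lab n R true i k = la n R (i, k) ∧
      lab n R false i k = lb n R (i, k) := by
  have base1 : ∀ k, lab n R true n k = la n R (n, k) := by
    intro k
    rw [lab_true_n]
    unfold la
    rw [wR_fix_inv]
    · simp only [dl]; omega
    · intro q hq
      rw [aft, Finset.mem_filter] at hq; simp only [bef] at hq
      have := hR q hq.1
      simp only [dl]; omega
  have base2 : ∀ i k, k ≤ 0 → lab n R false i k = lb n R (i, k) := by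
    intro i k hk
    rw [lab_false_nonpos hk]
    unfold lb
    rw [wR_fix_inv]
    · simp only [dl]
    · intro q hq
      rw [aft, Finset.mem_filter] at hq; simp only [bef] at hq
      have := hR q hq.1
      omega
  intro m
  induction m with
  | zero =>
    intro i k hi hm
    have : i = n := by omega
    subst this
    exact ⟨base1 k, base2 _ k (by omega)⟩
  | succ m ih =>
    intro i k hi hm
    constructor
    · rcases eq_or_lt_of_le hi with rfl | hlt
      · exact base1 k
      · have hh := ih (i + 1) k (by omega) (by omega)
        have hc := cut_lab (n := n) (R := R) (P := (i, k)) (p := (i + 1, k))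
          (x := dl n (i, k) + 1) (by simp [bef]) (by
            intro q hq h1 h2
            simp only [bef] at h1 h2
            omega)
        have e : dl n (i, k) + 1 = dl n (i + 1, k) := by simp only [dl]; omega
        conv_rhs => unfold la
        rw [hc, e]
        by_cases h : (i + 1, k) ∈ R
        · rw [lab_true_mem hlt h, if_pos h, sT_left]; exact hh.1
        · rw [lab_true_not hlt h, if_neg h]; exact hh.2
    · rcases le_or_gt k 0 with hk | hk
      · exact base2 i k hk
      · have hh := ih i (k - 1) hi (by omega)
        have hc := cut_lab (n := n) (R := R) (P := (i, k)) (p := (i, k - 1))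
          (x := dl n (i, k)) (by simp [bef]) (by
            intro q hq h1 h2
            simp only [bef] at h1 h2
            simp only [dl]
            omega)
        have e : dl n (i, k) = dl n (i, k - 1) + 1 := by simp only [dl]; omega
        conv_rhs => unfold lb
        rw [hc, e]
        by_cases h : (i, k - 1) ∈ R
        · rw [lab_false_mem hk h, if_pos h, sT_right]; exact hh.2
        · rw [lab_false_not hk h, if_neg h]; exact hh.1

lemma Grid.la {n : ℤ} {R : Finset (ℤ × ℤ)} (hR : Grid n R) {p : ℤ × ℤ} (hp : p.1 ≤ n) :
    lab n R true p.1 p.2 = RCGraphs.la n R p := (lab_perm hR _ p.1 p.2 hp le_rfl).1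
lemma Grid.lb {n : ℤ} {R : Finset (ℤ × ℤ)} (hR : Grid n R) {p : ℤ × ℤ} (hp : p.1 ≤ n) :
    lab n R false p.1 p.2 = RCGraphs.lb n R p := (lab_perm hR _ p.1 p.2 hp le_rfl).2

lemma toggle_aux {n : ℤ} {R : Finset (ℤ × ℤ)} {p c : ℤ × ℤ} (hp : p ∉ R) (h : bef c p) (x : ℤ) :
    (wR n (aft (insert p R) c))⁻¹ x =
      Equiv.swap (la n R p) (lb n R p) ((wR n (aft R c))⁻¹ x) := by
  have h1 : p ∈ aft (insert p R) c := Finset.mem_filter.2 ⟨by simp, h⟩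
  have h2 : p ∉ aft R c := fun h => hp (Finset.mem_filter.1 h).1
  have h3 : befo (aft (insert p R) c) p = befo (aft R c) p := by
    ext q
    simp only [befo, aft, Finset.mem_filter, Finset.mem_insert]
    constructor
    · rintro ⟨⟨rfl | a, b⟩, d⟩
      · unfold bef at d; omega
      · exact ⟨⟨a, b⟩, d⟩
    · rintro ⟨⟨a, b⟩, d⟩; exact ⟨⟨Or.inr a, b⟩, d⟩
  have h4 : aft (insert p R) p = aft R p := by
    ext q
    simp only [aft, Finset.mem_filter, Finset.mem_insert]
    constructor
    · rintro ⟨rfl | a, b⟩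
      · unfold bef at b; omega
      · exact ⟨a, b⟩
    · rintro ⟨a, b⟩; exact ⟨Or.inr a, b⟩
  rw [wR_split h1, wR_cut h2, aft_aft h, aft_aft h, h3, h4]
  unfold la lb
  rw [Equiv.swap_apply_apply, Equiv.swap_comm]
  simp [sT, mul_inv_rev]

lemma toggle {n : ℤ} {R : Finset (ℤ × ℤ)} {p c : ℤ × ℤ} (hp : p ∉ R) (h : bef c p) :
    la n (insert p R) c = Equiv.swap (la n R p) (lb n R p) (la n R c) ∧
    lb n (insert p R) c = Equiv.swap (la n R p) (lb n R p) (lb n R c) :=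
  ⟨toggle_aux hp h _, toggle_aux hp h _⟩

lemma toggle_not {n : ℤ} {R : Finset (ℤ × ℤ)} {p c : ℤ × ℤ} (h : ¬ bef c p) :
    la n (insert p R) c = la n R c ∧ lb n (insert p R) c = lb n R c := by
  have h4 : aft (insert p R) c = aft R c := by
    ext q
    simp only [aft, Finset.mem_filter, Finset.mem_insert]
    constructor
    · rintro ⟨rfl | a, b⟩
      · exact absurd b h
      · exact ⟨a, b⟩
    · rintro ⟨a, b⟩; exact ⟨Or.inr a, b⟩
  unfold la lb
  rw [h4]
  exact ⟨rfl, rfl⟩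

/-! ### Valid diagrams -/

def Valid (n : ℕ) (R : Finset (ℤ × ℤ)) : Prop :=
  ∀ p ∈ R, p.1 ≤ n ∧ 1 ≤ p.2 ∧ p.2 ≤ n ∧ 0 < lab n R true p.1 p.2 ∧
    lab n R false p.1 p.2 < lab n R true p.1 p.2

lemma Valid.grid {n : ℕ} {R : Finset (ℤ × ℤ)} (h : Valid n R) : Grid n R :=
  fun q hq => ⟨(h q hq).1, (h q hq).2.1⟩

lemma Valid.isRC {n : ℕ} {R : Finset (ℤ × ℤ)} (h : Valid n R) : IsRC n R := by
  refine isRC_of_good R (fun p hp => ⟨(h p hp).1, (h p hp).2.2.1⟩) ?_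
  intro p hp
  have := (h p hp).2.2.2.2
  rwa [h.grid.la (h p hp).1, h.grid.lb (h p hp).1] at this

lemma star_mono {n : ℤ} {R : Finset (ℤ × ℤ)} (hS : Star n R) (a : ℤ) (ha : a ≤ 0) :
    ∀ m : ℕ, wR n R (a - 1 - m) < wR n R a := by
  intro m
  induction m with
  | zero => simpa using hS a ha
  | succ m ih =>
    refine lt_trans ?_ ih
    have := hS (a - 1 - m) (by omega)
    rwa [show a - 1 - ((m + 1 : ℕ) : ℤ) = a - 1 - m - 1 by push_cast; ring]

lemma valid_of {n : ℕ} {R : Finset (ℤ × ℤ)} (hR : IsRC n R) (hS : Star n R) : Valid n R := by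
  have hpos : ∀ p ∈ R, 0 < la n R p := by
    intro p hp
    by_contra hcon
    have h1 := hR.good hp
    have h2 := hR.good_up hp
    have h3 := star_mono hS (la n R p) (by omega) ((la n R p - 1 - lb n R p).toNat)
    rw [show la n R p - 1 - ((la n R p - 1 - lb n R p).toNat : ℤ) = lb n R p by omega] at h3
    omega
  have hg : Grid n R := by
    intro p hp
    have hp1 := (hR.1 p hp).1
    refine ⟨hp1, ?_⟩
    by_contra hcon
    have h1 := hpos p hp
    have h2 : wR n (aft R p) (la n R p) = la n R p := by
      apply wR_fix
      intro q hq
      rw [aft, Finset.mem_filter] at hq; simp only [bef] at hq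
      have := (hR.1 q hq.1).1
      simp only [dl]; omega
    have h3 : wR n (aft R p) (la n R p) = dl n p + 1 := by simp [la]
    rw [h2] at h3
    simp only [dl] at h3
    omega
  intro p hp
  have h1 := hR.1 p hp
  have h2 := hg p hp
  rw [hg.la h1.1, hg.lb h1.1]
  exact ⟨h1.1, h2.2, h1.2, hpos p hp, hR.good hp⟩

/-! ### Rows of a diagram -/

def D (n : ℕ) (R : Finset (ℤ × ℤ)) (k : ℕ) : St where
  f x := (lab n R false ((n : ℤ) - x) k).toNat
  c x := (lab n R true ((n : ℤ) - x) k).toNat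
  g x := (lab n R false ((n : ℤ) - x) ((k : ℤ) + 1)).toNat
  C := {x | (((n : ℤ) - x, (k : ℤ)) : ℤ × ℤ) ∈ R}

lemma D_g (n : ℕ) (R : Finset (ℤ × ℤ)) (k : ℕ) : (D n R k).g = (D n R (k + 1)).f := by
  funext x; simp [D]

lemma D_mem {n : ℕ} {R : Finset (ℤ × ℤ)} {k x : ℕ} :
    x ∈ (D n R k).C ↔ (((n : ℤ) - x, (k : ℤ)) : ℤ × ℤ) ∈ R := Iff.rfl

lemma far {n : ℕ} (R : Finset (ℤ × ℤ)) : ∃ M : ℕ, ∀ x : ℕ, M ≤ x → ∀ k : ℤ,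
    (((n : ℤ) - x, k) : ℤ × ℤ) ∉ R := by
  refine ⟨R.sup (fun p => ((n : ℤ) - p.1).toNat) + 1, ?_⟩
  intro x hx k hk
  have := Finset.le_sup (f := fun p : ℤ × ℤ => ((n : ℤ) - p.1).toNat) hk
  simp only at this
  omega

lemma far_lab {n M : ℕ} {R : Finset (ℤ × ℤ)} (hM : ∀ x : ℕ, M ≤ x → ∀ k : ℤ,
    (((n : ℤ) - x, k) : ℤ × ℤ) ∉ R) (k : ℕ) : ∀ x : ℕ, M + k ≤ x →
    lab n R false ((n : ℤ) - x) k ≤ 0 := by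
  induction k with
  | zero => intro x hx; rw [lab_false_nonpos (by simp)]; simp
  | succ k ih =>
    intro x hx
    have h1 : (((n : ℤ) - x, ((k + 1 : ℕ) : ℤ) - 1) : ℤ × ℤ) ∉ R := hM x (by omega) _
    rw [lab_false_not (by push_cast; omega) h1]
    have h2 : (((n : ℤ) - x + 1, ((k + 1 : ℕ) : ℤ) - 1) : ℤ × ℤ) ∉ R := by
      have := hM (x - 1) (by omega) (((k + 1 : ℕ) : ℤ) - 1)
      rwa [show (n : ℤ) - ((x - 1 : ℕ) : ℤ) = n - x + 1 by omega] at this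
    rw [lab_true_not (by omega) h2]
    have := ih (x - 1) (by omega)
    rw [show (n : ℤ) - ((x - 1 : ℕ) : ℤ) = n - x + 1 by omega] at this
    rwa [show ((k + 1 : ℕ) : ℤ) - 1 = (k : ℤ) by push_cast; ring]

/-- The recursive structure of rows, without crossing inequality. -/
lemma D_rec {n : ℕ} {R : Finset (ℤ × ℤ)} (k : ℕ) (x : ℕ) :
    (x ∈ (D n R k).C → (D n R k).c (x + 1) = (D n R k).c x ∧ (D n R k).g x = (D n R k).f x) ∧
    (x ∉ (D n R k).C → (D n R k).c (x + 1) = (D n R k).f x ∧ (D n R k).g x = (D n R k).c x) := by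
  have e1 : (n : ℤ) - ((x + 1 : ℕ) : ℤ) + 1 = n - x := by push_cast; ring
  have e2 : (k : ℤ) + 1 - 1 = k := by ring
  constructor
  · intro h
    rw [D_mem] at h
    constructor
    · simp only [D]
      rw [lab_true_mem (by push_cast; omega) (by rw [e1]; exact h), e1]
    · simp only [D]
      rw [lab_false_mem (by omega) (by rw [e2]; exact h), e2]
  · intro h
    rw [D_mem] at h
    constructor
    · simp only [D]
      rw [lab_true_not (by push_cast; omega) (by rw [e1]; exact h), e1]
    · simp only [D]
      rw [lab_false_not (by omega) (by rw [e2]; exact h), e2]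

lemma D_row {n : ℕ} {R : Finset (ℤ × ℤ)} (k : ℕ)
    (hlt : ∀ x ∈ (D n R k).C, (D n R k).f x < (D n R k).c x) : Row k (D n R k) := by
  refine ⟨?_, fun x h => ((D_rec k x).1 h).1, fun x h => ((D_rec k x).2 h).1,
    fun x h => ((D_rec k x).1 h).2, fun x h => ((D_rec k x).2 h).2, hlt, ?_⟩
  · simp only [D]
    have : (n : ℤ) - ((0 : ℕ) : ℤ) = n := by simp
    rw [this, lab_true_n]; simp
  · obtain ⟨M, hM⟩ := far (n := n) R
    have hf := far_lab hM k
    have hC : ∀ x, M ≤ x → x ∉ (D n R k).C := fun x hx => hM x hx _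
    have hf' : ∀ x, M + k ≤ x → (D n R k).f x = 0 := by
      intro x hx
      have := hf x hx
      simp only [D]; omega
    have hc' : ∀ x, M + k + 1 ≤ x → (D n R k).c x = 0 := by
      intro x hx
      obtain ⟨y, rfl⟩ : ∃ y, x = y + 1 := ⟨x - 1, by omega⟩
      rw [((D_rec k y).2 (hC y (by omega))).1]
      exact hf' y (by omega)
    refine ⟨M + k + 1, fun x hx => ⟨hf' x (by omega), hc' x hx, ?_, hC x (by omega)⟩⟩
    rw [((D_rec k x).2 (hC x (by omega))).2]
    exact hc' x hx

lemma Valid.row {n : ℕ} {R : Finset (ℤ × ℤ)} (h : Valid n R) (k : ℕ) : Row k (D n R k) := by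
  apply D_row
  intro x hx
  have := h _ hx
  simp only [D]
  simp only at this
  omega

/-- Validity from rows. -/
lemma valid_of_rows {n : ℕ} {R : Finset (ℤ × ℤ)} (hg : ∀ p ∈ R, p.1 ≤ n ∧ 1 ≤ p.2 ∧ p.2 ≤ n)
    (h : ∀ k, 1 ≤ k → k ≤ n → ∀ x ∈ (D n R k).C, (D n R k).f x < (D n R k).c x) : Valid n R := by
  intro p hp
  obtain ⟨h1, h2, h3⟩ := hg p hp
  refine ⟨h1, h2, h3, ?_⟩
  have hpe : p = ((n : ℤ) - ((n - p.1).toNat : ℕ), ((p.2.toNat : ℕ) : ℤ)) := by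
    apply Prod.ext
    · simp only; omega
    · simp only; omega
  have := h p.2.toNat (by omega) (by omega) (n - p.1).toNat (by rw [D_mem, ← hpe]; exact hp)
  simp only [D] at this
  rw [show (n : ℤ) - (((n : ℤ) - p.1).toNat : ℤ) = p.1 by omega,
    show ((p.2.toNat : ℕ) : ℤ) = p.2 by omega] at this
  omega

lemma eq_of_rows {n : ℕ} {R Q : Finset (ℤ × ℤ)} (hR : Valid n R) (hQ : Valid n Q)
    (h : ∀ k, 1 ≤ k → k ≤ n → D n R k = D n Q k) : R = Q := by
  have key : ∀ {R Q : Finset (ℤ × ℤ)}, Valid n R → (∀ k, 1 ≤ k → k ≤ n → D n R k = D n Q k) →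
      ∀ p ∈ R, p ∈ Q := by
    intro R Q hR h p hp
    obtain ⟨h1, h2, h3, -⟩ := hR p hp
    have hpe : p = ((n : ℤ) - ((n - p.1).toNat : ℕ), ((p.2.toNat : ℕ) : ℤ)) := by
      apply Prod.ext
      · simp only; omega
      · simp only; omega
    have hm : (n - p.1).toNat ∈ (D n R p.2.toNat).C := by rw [D_mem, ← hpe]; exact hp
    rw [h _ (by omega) (by omega), D_mem, ← hpe] at hm
    exact hm
  ext p
  exact ⟨key hR h p, key hQ (fun k a b => (h k a b).symm) p⟩

/-! ### Positions in a row -/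

def pt (n x k : ℕ) : ℤ × ℤ := ((n : ℤ) - x, (k : ℤ))

lemma mem_pt {n x k : ℕ} {R : Finset (ℤ × ℤ)} : x ∈ (D n R k).C ↔ pt n x k ∈ R := Iff.rfl

lemma pt_inj {n x k y j : ℕ} : pt n x k = pt n y j ↔ x = y ∧ k = j := by
  simp only [pt, Prod.mk.injEq]; omega

lemma exists_pt {n : ℕ} {p : ℤ × ℤ} (h1 : p.1 ≤ n) (h2 : 1 ≤ p.2) : ∃ x k, p = pt n x k := by
  refine ⟨(n - p.1).toNat, p.2.toNat, ?_⟩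
  apply Prod.ext
  · simp only [pt]; omega
  · simp only [pt]; omega

/-- A row of a diagram is determined by its south labels and crossings. -/
lemma D_det {n : ℕ} {R : Finset (ℤ × ℤ)} {k : ℕ} {T : St} (hT : Row k T)
    (hf : (D n R k).f = T.f) (hC : (D n R k).C = T.C) : D n R k = T := by
  have hc : (D n R k).c = T.c := by
    funext x
    induction x with
    | zero =>
      rw [hT.c0]
      simp only [D]
      have : (n : ℤ) - ((0 : ℕ) : ℤ) = n := by simp
      rw [this, lab_true_n]; simp
    | succ x ih =>
      by_cases hx : x ∈ (D n R k).C
      · rw [((D_rec k x).1 hx).1, hT.cm x (hC ▸ hx), ih]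
      · rw [((D_rec k x).2 hx).1, hT.cn x (hC ▸ hx), hf]
  refine St.ext' hf hc ?_ hC
  funext x
  by_cases hx : x ∈ (D n R k).C
  · rw [((D_rec k x).1 hx).2, hT.gm x (hC ▸ hx), hf]
  · rw [((D_rec k x).2 hx).2, hT.gn x (hC ▸ hx), hc]

lemma D_zero_f {n : ℕ} {R : Finset (ℤ × ℤ)} : (D n R 0).f = fun _ => 0 := by
  funext x
  simp only [D]
  rw [lab_false_nonpos (by simp)]
  simp only [Nat.cast_zero]
  omega

lemma D_congr {n : ℕ} {R S : Finset (ℤ × ℤ)} (hS : Valid n S) {j : ℕ}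
    (hf : (D n R j).f = (D n S j).f) (hC : (D n R j).C = (D n S j).C) : D n R j = D n S j :=
  D_det (hS.row j) hf hC

lemma D_low {n : ℕ} {R S : Finset (ℤ × ℤ)} (hS : Valid n S) {k : ℕ}
    (hC : ∀ j, j < k → (D n R j).C = (D n S j).C) :
    (∀ j, j < k → D n R j = D n S j) ∧ (D n R k).f = (D n S k).f := by
  induction k with
  | zero => exact ⟨fun j hj => by omega, by rw [D_zero_f, D_zero_f]⟩
  | succ k ih =>
    obtain ⟨h1, h2⟩ := ih (fun j hj => hC j (by omega))
    have h3 : D n R k = D n S k := D_congr hS h2 (hC k (by omega))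
    refine ⟨fun j hj => ?_, ?_⟩
    · rcases Nat.lt_or_ge j k with h | h
      · exact h1 j h
      · rw [show j = k by omega]; exact h3
    · rw [← D_g, ← D_g, h3]

lemma D_high {n : ℕ} {R S : Finset (ℤ × ℤ)} (hS : Valid n S) {k : ℕ}
    (hg : (D n R k).g = (D n S k).g)
    (hC : ∀ j, k < j → (D n R j).C = (D n S j).C) :
    ∀ j, k < j → D n R j = D n S j := by
  have : ∀ d, D n R (k + 1 + d) = D n S (k + 1 + d) := by
    intro d
    induction d with
    | zero => exact D_congr hS (by rw [Nat.add_zero, ← D_g, ← D_g, hg]) (hC _ (by omega))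
    | succ d ih =>
      refine D_congr hS ?_ (hC _ (by omega))
      rw [show k + 1 + (d + 1) = (k + 1 + d) + 1 by omega, ← D_g, ← D_g, ih]
  intro j hj
  rw [show j = k + 1 + (j - k - 1) by omega]
  exact this _

/-- labels travel along jumps -/
lemma lab_sg {n : ℕ} {S : Finset (ℤ × ℤ)} {x r : ℕ} (h : x ∉ (D n S r).C → x + 1 ∉ (D n S r).C) :
    lab n S false ((n : ℤ) - (sg (D n S r).C x : ℕ)) ((r + 1 : ℕ) : ℤ) =
      lab n S false ((n : ℤ) - x) (r : ℤ) := by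
  have e2 : ((r + 1 : ℕ) : ℤ) - 1 = r := by push_cast; ring
  by_cases hx : x ∈ (D n S r).C
  · rw [sg_mem hx, lab_false_mem (by push_cast; omega) (by rw [e2]; exact hx), e2]
  · have h1 := h hx
    have e1 : (n : ℤ) - ((x + 1 : ℕ) : ℤ) + 1 = n - x := by push_cast; ring
    rw [sg_not hx, lab_false_not (by push_cast; omega) (by rw [e2]; exact h1), e2,
      lab_true_not (by push_cast; omega) (by rw [e1]; exact hx), e1]

lemma open_iff {n : ℕ} {S : Finset (ℤ × ℤ)} {x r : ℕ} :
    OpenSpace n S ((n : ℤ) - x) (r : ℤ) ↔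
      x ∉ (D n S r).C ∧ (D n S r).f x = 0 ∧ 0 < (D n S r).c x := by
  unfold OpenSpace
  rw [mem_pt]
  simp only [D, pt]
  constructor
  · rintro ⟨a, b, c, d⟩; exact ⟨b, by omega, by omega⟩
  · rintro ⟨b, c, d⟩; exact ⟨by omega, b, by omega, by omega⟩

/-- the position chosen by the algorithm -/
lemma sInf_open {n : ℕ} {S : Finset (ℤ × ℤ)} {r q i : ℕ} (hr : Row r (D n S r))
    (hq : (D n S r).c q = 0) (hE : Emit (D n S r).g i q) :
    sInf {x : ℤ | (n : ℤ) - q < x ∧ OpenSpace n S x r} = (n : ℤ) - i := by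
  obtain ⟨h1, h2, h3, -⟩ := hr.emit_facts hq hE
  have hp := hr.carr_prop hq hE.2.2
  apply IsLeast.csInf_eq
  constructor
  · exact ⟨by have := hE.1; omega, open_iff.2 ⟨h1, h2, h3⟩⟩
  · rintro x ⟨hx, hO⟩
    obtain ⟨y, rfl⟩ : ∃ y : ℕ, x = (n : ℤ) - y := ⟨(n - x).toNat, by have := hO.1; omega⟩
    obtain ⟨-, -, hc⟩ := open_iff.1 hO
    by_contra hcon
    have := hp y (by omega) (by omega)
    omega

lemma sInf_open' {n : ℕ} {S : Finset (ℤ × ℤ)} {r q i : ℕ} (hr : Row r (D n S r))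
    (hq : ∀ x, q ≤ x → (D n S r).c x = 0) (hE : Emit (D n S r).g i q) :
    sInf {x : ℤ | OpenSpace n S x r} = (n : ℤ) - i := by
  rw [← sInf_open hr (hq q le_rfl) hE]
  congr 1
  ext x
  simp only [Set.mem_setOf_eq]
  refine ⟨fun hO => ⟨?_, hO⟩, fun h => h.2⟩
  obtain ⟨y, rfl⟩ : ∃ y : ℕ, x = (n : ℤ) - y := ⟨(n - x).toNat, by have := hO.1; omega⟩
  obtain ⟨-, -, hc⟩ := open_iff.1 hO
  by_contra hcon
  have := hq y (by omega)
  omega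

/-! ### Following the two strands -/

/-- State of the comparison of `S` and `T` after row `K`. -/
structure Climb (n : ℕ) (S T : Finset (ℤ × ℤ)) (a b : ℤ) (k K : ℕ) (o : ℕ → Ev) : Prop where
  steps : ∀ r, k < r → r ≤ K → Step r (D n S r) (D n T r) (o (r - 1)) (o r)
  st : (o K).st = false
  j : Jump (D n S K).g (o K).p (o K).q
  g : (D n T K).g = app (D n S K).g (o K).p (o K).q
  la : lab n S false ((n : ℤ) - (o K).p) ((K + 1 : ℕ) : ℤ) = a
  lb : lab n S false ((n : ℤ) - (o K).q) ((K + 1 : ℕ) : ℤ) = b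

lemma Climb.next {n : ℕ} {S T : Finset (ℤ × ℤ)} {a b : ℤ} {k K : ℕ} {o : ℕ → Ev}
    (h : Climb n S T a b k K o) (hS : Valid n S) (hkK : k ≤ K)
    (hC : (D n T (K + 1)).C = (D n S (K + 1)).C)
    (hA : ¬ Absorb (D n S (K + 1)).C (o K).p (o K).q) :
    ∃ e, Climb n S T a b k (K + 1) (fun r => if r ≤ K then o r else e) := by
  have hr := hS.row (K + 1)
  have hJ : Jump (D n S (K + 1)).f (o K).p (o K).q := by rw [← D_g]; exact h.j
  have hfT : (D n T (K + 1)).f = app (D n S (K + 1)).f (o K).p (o K).q := by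
    rw [← D_g, ← D_g]; exact h.g
  obtain ⟨⟨c', hrow⟩, hJ'⟩ := hr.pass hJ hA
  have hD := D_det hrow hfT hC
  refine ⟨⟨false, sg (D n S (K + 1)).C (o K).p, sg (D n S (K + 1)).C (o K).q⟩, ?_, ?_, ?_, ?_, ?_, ?_⟩
  · intro r h1 h2
    rcases Nat.lt_or_ge K r with h3 | h3
    · have : r = K + 1 := by omega
      subst this
      simp only [Nat.add_sub_cancel, le_refl, if_true]
      rw [if_neg (by omega)]
      refine ⟨hr, by rw [hD]; exact hrow, Or.inr ⟨h.st, hJ⟩, ?_, ?_, Or.inl ⟨h.st, hA, hC, rfl⟩⟩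
      · rw [hfT]; simp [fapp, h.st]
      · rw [hD]
    · rw [if_pos (by omega), if_pos h3]
      exact h.steps r h1 h3
  · simp
  · simpa using hJ'
  · simp only [show ¬ (K + 1 ≤ K) by omega, if_false]
    rw [hD]
  · simp only [show ¬ (K + 1 ≤ K) by omega, if_false]
    rw [lab_sg, h.la]
    intro hp
    by_cases e : (o K).p + 1 < (o K).q
    · exact hr.noC hJ hp e
    · have := hJ.1
      have e : (o K).q = (o K).p + 1 := by omega
      intro v
      exact hA ⟨e, hp, e ▸ v⟩
  · simp only [show ¬ (K + 1 ≤ K) by omega, if_false]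
    rw [lab_sg, h.lb]
    intro hp
    exact (hr.noC' hJ.2.2.1 hp).1

lemma climb {n : ℕ} {S T : Finset (ℤ × ℤ)} {a b : ℤ} {k : ℕ} {e : Ev} (hS : Valid n S)
    (h : Climb n S T a b k k (fun _ => e)) (hC : ∀ r, k < r → (D n T r).C = (D n S r).C) :
    ∀ K, k ≤ K → ∃ o, o k = e ∧ (Climb n S T a b k K o ∨
      ∃ r, k ≤ r ∧ r < K ∧ Climb n S T a b k r o ∧ Absorb (D n S (r + 1)).C (o r).p (o r).q) := by
  intro K hK
  induction K, hK using Nat.le_induction with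
  | base => exact ⟨_, rfl, Or.inl h⟩
  | succ K hK ih =>
    obtain ⟨o, ho, hc | ⟨r, h1, h2, h3⟩⟩ := ih
    · by_cases hA : Absorb (D n S (K + 1)).C (o K).p (o K).q
      · exact ⟨o, ho, Or.inr ⟨K, hK, by omega, hc, hA⟩⟩
      · obtain ⟨e', he⟩ := hc.next hS hK (hC _ (by omega)) hA
        exact ⟨_, by simp [hK, ho], Or.inl he⟩
    · exact ⟨o, ho, Or.inr ⟨r, h1, by omega, h3⟩⟩

/-! ### The main loop -/

lemma steps_last {n : ℤ} {fuel : ℕ} {T Rf : Finset (ℤ × ℤ)} {p : ℤ × ℤ} (hT : IsRC n T)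
    (h : T = Rf) (d : Finset (ℤ × ℤ) × (ℤ × ℤ)) :
    ((insertSteps n (fuel + 1) T p).getLast?.getD d).1 = Rf := by
  rw [insertSteps, if_pos hT, List.getLast?_cons, Option.getD_some]
  exact h

lemma steps_next {n : ℤ} {fuel : ℕ} {T Rf : Finset (ℤ × ℤ)} {p q : ℤ × ℤ} {i' : ℤ}
    (hT : ¬ IsRC n T)
    (hq : (T.filter fun q => q ≠ p ∧
      ((lab n T true q.1 q.2 = lab n T true p.1 p.2 ∧ lab n T false q.1 q.2 = lab n T false p.1 p.2) ∨
       (lab n T true q.1 q.2 = lab n T false p.1 p.2 ∧ lab n T false q.1 q.2 = lab n T true p.1 p.2)))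
      = {q})
    (hi : sInf {x : ℤ | q.1 < x ∧ OpenSpace n (T.erase q) x q.2} = i')
    (h : ∀ d, ((insertSteps n fuel (insert (i', q.2) (T.erase q)) (i', q.2)).getLast?.getD d).1 = Rf)
    (d : Finset (ℤ × ℤ) × (ℤ × ℤ)) :
    ((insertSteps n (fuel + 1) T p).getLast?.getD d).1 = Rf := by
  rw [insertSteps, if_neg hT, List.getLast?_cons, Option.getD_some]
  simp only [hq, Finset.sort_singleton, List.headI_cons, hi]
  exact h _

lemma swap_set {a b x y : ℤ} (h : (Equiv.swap a b x = a ∧ Equiv.swap a b y = b) ∨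
    (Equiv.swap a b x = b ∧ Equiv.swap a b y = a)) : (x = a ∧ y = b) ∨ (x = b ∧ y = a) := by
  have h1 : ∀ z, Equiv.swap a b z = a → z = b := by
    intro z hz
    have := congrArg (Equiv.swap a b) hz
    simpa using this
  have h2 : ∀ z, Equiv.swap a b z = b → z = a := by
    intro z hz
    have := congrArg (Equiv.swap a b) hz
    simpa using this
  rcases h with ⟨u, v⟩ | ⟨u, v⟩
  · exact Or.inr ⟨h1 _ u, h2 _ v⟩
  · exact Or.inl ⟨h2 _ u, h1 _ v⟩

lemma loop (n : ℕ) : ∀ fuel : ℕ, ∀ (S : Finset (ℤ × ℤ)) (k x0 : ℕ), Valid n S → 1 ≤ k → k ≤ n →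
    n + 1 - k ≤ fuel → (∃ q, (D n S k).c q = 0 ∧ Emit (D n S k).g x0 q) →
    ∃ (Rf : Finset (ℤ × ℤ)) (o : ℕ → Ev),
      (∀ d, ((insertSteps n fuel (insert (pt n x0 k) S) (pt n x0 k)).getLast?.getD d).1 = Rf) ∧
      Valid n Rf ∧ o k = ⟨false, x0, x0 + 1⟩ ∧ (∀ j, j < k → D n Rf j = D n S j) ∧
      (D n Rf k).f = (D n S k).f ∧ (D n Rf k).C = (D n S k).C ∪ {x0} ∧
      (D n Rf k).g = app (D n S k).g x0 (x0 + 1) ∧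
      ∀ r, k < r → r ≤ n → Step r (D n S r) (D n Rf r) (o (r - 1)) (o r) := by
  intro fuel
  induction fuel with
  | zero => intro S k x0 _ _ h1 h2; omega
  | succ fuel ih =>
    intro S k x0 hS hk1 hkn hfuel hqe
    obtain ⟨q, hcq, hE⟩ := hqe
    have hrk := hS.row k
    obtain ⟨f1, f2, f3, f4, f5, f6⟩ := hrk.emit_facts hcq hE
    obtain ⟨⟨c', hrow⟩, hJ⟩ := hrk.emit hcq hE
    set p := pt n x0 k with hp
    set T := insert p S with hT
    have hpS : p ∉ S := f1
    -- rows of `T`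
    have hTC : ∀ r, r ≠ k → (D n T r).C = (D n S r).C := by
      intro r hr
      ext y
      rw [mem_pt, mem_pt, hT, Finset.mem_insert, hp, pt_inj]
      constructor
      · rintro (h | h)
        · exact absurd h.2 hr
        · exact h
      · exact Or.inr
    have hTCk : (D n T k).C = (D n S k).C ∪ {x0} := by
      ext y
      rw [mem_pt, hT, Finset.mem_insert, hp, pt_inj, Set.mem_union, mem_pt, Set.mem_singleton_iff]
      tauto
    obtain ⟨low1, low2⟩ := D_low (R := T) hS (k := k) (fun j hj => hTC j (by omega))
    have hDk := D_det hrow low2 hTCk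
    -- initial labels
    have hpg : p.1 ≤ n ∧ 1 ≤ p.2 ∧ p.2 ≤ n := by
      simp only [hp, pt]; omega
    have hTg : ∀ q ∈ T, q.1 ≤ n ∧ 1 ≤ q.2 ∧ q.2 ≤ n := by
      intro q hq
      rcases Finset.mem_insert.1 hq with rfl | hq
      · exact hpg
      · exact ⟨(hS q hq).1, (hS q hq).2.1, (hS q hq).2.2.1⟩
    have hTgr : Grid n T := fun q hq => ⟨(hTg q hq).1, (hTg q hq).2.1⟩
    have ela : lab n S true p.1 p.2 = la n S p := hS.grid.la hpg.1
    have elb : lab n S false p.1 p.2 = lb n S p := hS.grid.lb hpg.1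
    have hcl : Climb n S T (la n S p) (lb n S p) k k (fun _ => ⟨false, x0, x0 + 1⟩) := by
      refine ⟨fun r h1 h2 => by omega, rfl, hJ, ?_, ?_, ?_⟩
      · rw [hDk]
      · have e2 : ((k + 1 : ℕ) : ℤ) - 1 = k := by push_cast; ring
        rw [lab_false_not (by push_cast; omega) (by rw [e2]; exact f1), e2, ← ela]
        rfl
      · have e := lab_sg (n := n) (S := S) (x := x0) (r := k) (fun _ => f5)
        rw [sg_not f1] at e
        rw [e, ← elb]; rfl
    obtain ⟨o, hok, hcl | ⟨r0, h1, h2, hcl, hA⟩⟩ :=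
      climb hS hcl (fun r hr => hTC r (by omega)) n hkn
    · -- no conflict
      have hV : Valid n T := by
        apply valid_of_rows hTg
        intro j hj1 hj2 x hx
        rcases lt_trichotomy j k with h | h | h
        · rw [low1 j h] at hx ⊢; exact (hS.row j).lt x hx
        · subst h
          have : Row j (D n T j) := by rw [hDk]; exact hrow
          exact this.lt x hx
        · exact (hcl.steps j h hj2).r'.lt x hx
      exact ⟨T, o, steps_last hV.isRC rfl, hV, hok, low1, low2, hTCk, by rw [hDk], hcl.steps⟩
    · -- conflict at row `r0 + 1`
      set P := (o r0).p with hP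
      set Q := (o r0).q with hQ
      set q0 := pt n Q (r0 + 1) with hq0
      have hA' := hA
      obtain ⟨a1, a2, a3⟩ := hA'
      have hJf : Jump (D n S (r0 + 1)).f P Q := by rw [← D_g]; exact hcl.j
      have hTf : (D n T (r0 + 1)).f = app (D n S (r0 + 1)).f P Q := by
        rw [← D_g, ← D_g]; exact hcl.g
      have hq0S : q0 ∈ S := a3
      have hq0p : q0 ≠ p := by rintro h; exact hpS (h ▸ hq0S)
      have hq0T : q0 ∈ T := Finset.mem_insert_of_mem hq0S
      have hq0g := hS q0 hq0S
      have hbef : bef q0 p := by left; simp only [hq0, hp, pt]; push_cast; omega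
      have hnbef : ¬ bef p q0 := by unfold bef at *; omega
      have hnpp : ∀ s : ℤ × ℤ, ¬ bef s s := by intro s; unfold bef; omega
      -- labels at `q0` in `S`
      have l1 : la n S q0 = la n S p := by
        rw [← hS.grid.la hq0g.1, ← hcl.la]
        have e1 : (n : ℤ) - (Q : ℕ) + 1 = n - (P : ℕ) := by rw [a1]; push_cast; ring
        have := lab_true_not (n := n) (R := S) (i := (n : ℤ) - Q) (k := ((r0 + 1 : ℕ) : ℤ))
          (by omega) (by rw [e1]; exact a2)
        rw [e1] at this
        exact this
      have l2 : lb n S q0 = lb n S p := by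
        rw [← hS.grid.lb hq0g.1, ← hcl.lb]
        rfl
      -- labels in `T`
      have t1 : la n T q0 = lb n S p ∧ lb n T q0 = la n S p := by
        have := toggle (n := n) hpS hbef
        rw [l1, l2] at this
        simpa using this
      have t2 : la n T p = la n S p ∧ lb n T p = lb n S p := toggle_not (hnpp p)
      have hnRC : ¬ IsRC n T := by
        intro h
        refine h.noTwice hq0T (Finset.mem_insert_self _ _) hbef (Or.inr ?_)
        rw [t1.1, t1.2, t2.1, t2.2]; exact ⟨rfl, rfl⟩
      -- the diagram `R'`
      set R' := T.erase q0 with hR'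
      have hR'C : ∀ r, r ≠ r0 + 1 → (D n R' r).C = (D n T r).C := by
        intro r hr
        ext y
        rw [mem_pt, mem_pt, hR', Finset.mem_erase]
        refine ⟨fun h => h.2, fun h => ⟨?_, h⟩⟩
        rw [hq0, Ne, pt_inj]
        tauto
      have hR'C0 : (D n R' (r0 + 1)).C = (D n S (r0 + 1)).C \ {Q} := by
        rw [← hTC (r0 + 1) (by omega)]
        ext y
        rw [mem_pt, hR', Finset.mem_erase, hq0, Ne, pt_inj, Set.mem_diff, mem_pt,
          Set.mem_singleton_iff]
        tauto
      have hTrow : ∀ j, j ≤ r0 → Row j (D n T j) := by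
        intro j hj
        rcases lt_trichotomy j k with h | h | h
        · rw [low1 j h]; exact hS.row j
        · subst h; rw [hDk]; exact hrow
        · exact (hcl.steps j h hj).r'
      have hDlow : (∀ j, j < r0 + 1 → D n R' j = D n T j) ∧
          (D n R' (r0 + 1)).f = (D n T (r0 + 1)).f := by
        have key : ∀ m, m ≤ r0 + 1 → (∀ j, j < m → D n R' j = D n T j) ∧
            (D n R' m).f = (D n T m).f := by
          intro m
          induction m with
          | zero => intro _; exact ⟨fun j hj => by omega, by rw [D_zero_f, D_zero_f]⟩
          | succ m ihm =>
            intro hm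
            obtain ⟨u, v⟩ := ihm (by omega)
            have h3 : D n R' m = D n T m := D_det (hTrow m (by omega)) v (hR'C m (by omega))
            refine ⟨fun j hj => ?_, ?_⟩
            · rcases Nat.lt_or_ge j m with h | h
              · exact u j h
              · rw [show j = m by omega]; exact h3
            · rw [← D_g, ← D_g, h3]
        exact key _ le_rfl
      obtain ⟨c'', hrow'', hc''⟩ := (hS.row (r0 + 1)).absorb hJf hA
      have hD0 := D_det hrow'' (hDlow.2.trans hTf) hR'C0
      have hDhigh : ∀ j, r0 + 1 < j → D n R' j = D n S j := by
        apply D_high hS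
        · rw [hD0]
        · intro j hj
          rw [hR'C j (by omega), hTC j (by omega)]
      have hR'row : ∀ j, Row j (D n R' j) := by
        intro j
        rcases lt_trichotomy j (r0 + 1) with h | h | h
        · rw [hDlow.1 j h]; exact hTrow j (by omega)
        · subst h; rw [hD0]; exact hrow''
        · rw [hDhigh j h]; exact hS.row j
      have hV' : Valid n R' := by
        apply valid_of_rows
        · intro s hs; exact hTg s (Finset.mem_of_mem_erase hs)
        · intro j _ _ x hx; exact (hR'row j).lt x hx
      -- the conflicting crossing
      have hfilt : (T.filter fun q => q ≠ p ∧
          ((lab n T true q.1 q.2 = lab n T true p.1 p.2 ∧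
              lab n T false q.1 q.2 = lab n T false p.1 p.2) ∨
           (lab n T true q.1 q.2 = lab n T false p.1 p.2 ∧
              lab n T false q.1 q.2 = lab n T true p.1 p.2))) = {q0} := by
        ext s
        rw [Finset.mem_filter, Finset.mem_singleton]
        constructor
        · rintro ⟨hs, hsp, hl⟩
          by_contra hne
          have hs' : s ∈ R' := Finset.mem_erase.2 ⟨hne, hs⟩
          have hpR : p ∈ R' := Finset.mem_erase.2 ⟨hq0p.symm, Finset.mem_insert_self _ _⟩
          have hTe : T = insert q0 R' := (Finset.insert_erase hq0T).symm
          have hq0R : q0 ∉ R' := Finset.notMem_erase _ _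
          rw [hTgr.la (hTg s hs).1, hTgr.lb (hTg s hs).1, hTgr.la hpg.1, hTgr.lb hpg.1,
            t2.1, t2.2] at hl
          have r1 : la n R' q0 = lb n S p ∧ lb n R' q0 = la n S p := by
            have := toggle_not (n := n) (R := R') (hnpp q0)
            rw [← hTe] at this
            rw [← this.1, ← this.2]; exact t1
          have r2 : la n R' p = la n S p ∧ lb n R' p = lb n S p := by
            have := toggle_not (n := n) (R := R') hnbef
            rw [← hTe] at this
            rw [← this.1, ← this.2]; exact t2
          have hl' : (la n R' s = la n S p ∧ lb n R' s = lb n S p) ∨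
              (la n R' s = lb n S p ∧ lb n R' s = la n S p) := by
            by_cases hb : bef s q0
            · have := toggle (n := n) hq0R hb
              rw [← hTe, r1.1, r1.2, Equiv.swap_comm] at this
              rw [this.1, this.2] at hl
              exact swap_set hl
            · have := toggle_not (n := n) (R := R') hb
              rw [← hTe] at this
              rw [← this.1, ← this.2]; exact hl
          rw [← r2.1, ← r2.2] at hl'
          rcases bef_tri hsp with h | h
          · exact hV'.isRC.noTwice hs' hpR h hl'
          · refine hV'.isRC.noTwice hpR hs' h ?_
            rcases hl' with ⟨u, v⟩ | ⟨u, v⟩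
            · exact Or.inl ⟨u.symm, v.symm⟩
            · exact Or.inr ⟨v.symm, u.symm⟩
        · rintro rfl
          refine ⟨hq0T, hq0p, Or.inr ?_⟩
          rw [hTgr.la hq0g.1, hTgr.lb hq0g.1, hTgr.la hpg.1, hTgr.lb hpg.1,
            t2.1, t2.2]
          exact t1
      -- the next crossing
      have hcQ : (D n R' (r0 + 1)).c Q = 0 := by rw [hD0]; exact hc''
      obtain ⟨i, hi⟩ := (hR'row (r0 + 1)).emit_exists (by omega) hcQ
      have hsi := sInf_open (hR'row (r0 + 1)) hcQ hi
      obtain ⟨Rf, o', g1, g2, g3, g4, g5, g6, g7, g8⟩ :=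
        ih R' (r0 + 1) i hV' (by omega) (by omega) (by omega) ⟨Q, hcQ, hi⟩
      have hgS : (D n R' (r0 + 1)).g = (D n S (r0 + 1)).g := by rw [hD0]
      refine ⟨Rf, fun r => if r ≤ r0 then o r else o' r, steps_next hnRC hfilt hsi g1, g2, ?_, ?_,
        ?_, ?_, ?_, ?_⟩
      · simp only [h1, if_true]; exact hok
      · intro j hj
        rw [g4 j (by omega), hDlow.1 j (by omega), low1 j hj]
      · rw [g4 k (by omega), hDlow.1 k (by omega), low2]
      · rw [g4 k (by omega), hDlow.1 k (by omega), hTCk]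
      · rw [g4 k (by omega), hDlow.1 k (by omega), hDk]
      · intro r hr1 hr2
        simp only
        rcases lt_trichotomy r (r0 + 1) with h | h | h
        · rw [if_pos (by omega), if_pos (by omega), g4 r h, hDlow.1 r h]
          exact hcl.steps r hr1 (by omega)
        · subst h
          rw [Nat.add_sub_cancel, if_pos le_rfl, if_neg (by omega), g3]
          refine ⟨hS.row _, g2.row _, Or.inr ⟨hcl.st, hJf⟩, ?_, ?_, Or.inr ⟨Or.inr hA, i, ?_, ?_, rfl⟩⟩
          · rw [g5, hDlow.2, hTf]; simp [fapp, hcl.st, hP, hQ]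
          · rw [g7, hgS]
          · rw [← hgS]; exact hi
          · rw [g6, hR'C0]
        · rw [if_neg (by omega), if_neg (by omega), ← hDhigh r h]
          exact g8 r h hr2

lemma insertOne_spec {n m : ℕ} {R : Finset (ℤ × ℤ)} (hR : Valid n R) (h1 : 1 ≤ m) (h2 : m ≤ n) :
    Valid n (insertOne n R m) ∧ ∃ o, InsR n m (D n R) (D n (insertOne n R m)) o := by
  have hr := hR.row m
  obtain ⟨N, hN⟩ := hr.fin
  obtain ⟨i, hi⟩ := hr.emit_exists (by omega) (hN N le_rfl).2.1
  have hs := sInf_open' hr (fun x hx => (hN x hx).2.1) hi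
  obtain ⟨Rf, o, g1, g2, g3, g4, g5, g6, g7, g8⟩ :=
    loop n (((n : ℤ) + 1 - m).toNat + 1) R m i hR h1 h2 (by omega) ⟨N, (hN N le_rfl).2.1, hi⟩
  have e : insertOne n R m = Rf := by
    unfold insertOne insertStepsOf
    simp only [hs]
    exact g1 _
  rw [e]
  refine ⟨g2, o, fun k _ _ hk => g4 k hk, ⟨N, fun M hM => ?_⟩, g8⟩
  refine ⟨hr, g2.row m, Or.inl ⟨rfl, rfl, fun x hx => hN x (le_trans hM hx)⟩, ?_, ?_,
    Or.inr ⟨Or.inl rfl, i, ⟨by have := hi.1; simp only; omega, hi.2.1, ?_⟩, ?_, g3⟩⟩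
  · rw [g5]; simp [fapp]
  · rw [g7, g3]
  · intro x hx _
    rcases Nat.lt_or_ge x N with h | h
    · exact hi.2.2 x hx h
    · exact (hN x h).2.2.1
  · rw [g6]
    have : M + 1 ∉ (D n R m).C := (hN (M + 1) (by omega)).2.2.2
    simp [this]

/-! ### Knuth moves -/

lemma knuth1 {n x y z : ℕ} {R : Finset (ℤ × ℤ)} (hR : Valid n R) (h1 : 1 ≤ x) (h2 : x < y)
    (h3 : y ≤ z) (h4 : z ≤ n) :
    insertOne n (insertOne n (insertOne n R y) x) z =
      insertOne n (insertOne n (insertOne n R y) z) x := by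
  obtain ⟨v1, o1, a1⟩ := insertOne_spec (m := y) hR (by omega) (by omega)
  obtain ⟨v2, o2, a2⟩ := insertOne_spec (m := x) v1 (by omega) (by omega)
  obtain ⟨v3, o3, a3⟩ := insertOne_spec (m := z) v2 (by omega) (by omega)
  obtain ⟨w2, o4, b2⟩ := insertOne_spec (m := z) v1 (by omega) (by omega)
  obtain ⟨w3, o5, b3⟩ := insertOne_spec (m := x) w2 (by omega) (by omega)
  exact eq_of_rows v3 w3 (fun k k1 k2 => knuth_rows1 h1 h2 h3 a1 a2 a3 b2 b3 h4 k k1 k2)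

lemma knuth2 {n x y z : ℕ} {R : Finset (ℤ × ℤ)} (hR : Valid n R) (h1 : 1 ≤ x) (h2 : x ≤ y)
    (h3 : y < z) (h4 : z ≤ n) :
    insertOne n (insertOne n (insertOne n R x) z) y =
      insertOne n (insertOne n (insertOne n R z) x) y := by
  obtain ⟨v1, o1, a1⟩ := insertOne_spec (m := z) hR (by omega) (by omega)
  obtain ⟨v2, o2, a2⟩ := insertOne_spec (m := x) v1 (by omega) (by omega)
  obtain ⟨v3, o3, a3⟩ := insertOne_spec (m := y) v2 (by omega) (by omega)
  obtain ⟨w1, o6, b1⟩ := insertOne_spec (m := x) hR (by omega) (by omega)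
  obtain ⟨w2, o4, b2⟩ := insertOne_spec (m := z) w1 (by omega) (by omega)
  obtain ⟨w3, o5, b3⟩ := insertOne_spec (m := y) w2 (by omega) (by omega)
  exact eq_of_rows w3 v3 (fun k k1 k2 => (knuth_rows2 h1 h2 h3 a1 a2 a3 b1 b2 b3 h4 k k1 k2).symm)

lemma insertWord_valid {n : ℕ} (v : List ℕ) : ∀ R : Finset (ℤ × ℤ), Valid n R →
    (∀ a ∈ v, 1 ≤ a ∧ a ≤ n) → Valid n (insertWord n R v) := by
  induction v with
  | nil => intro R hR _; exact hR
  | cons a v ih =>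
    intro R hR h
    have ha := h a (by simp)
    exact ih _ (insertOne_spec hR ha.1 ha.2).1 (fun b hb => h b (by simp [hb]))

lemma insertWord_append {n : ℕ} (R : Finset (ℤ × ℤ)) (u v : List ℕ) :
    insertWord n R (u ++ v) = insertWord n (insertWord n R u) v := by
  simp [insertWord]

lemma insertWord_cons {n : ℕ} (R : Finset (ℤ × ℤ)) (a : ℕ) (v : List ℕ) :
    insertWord n R (a :: v) = insertWord n (insertOne n R a) v := rfl

lemma knuth_move {n : ℕ} {w₁ w₂ : List ℕ} (h : KnuthMove w₁ w₂) :
    ((∀ a ∈ w₁, 1 ≤ a ∧ a ≤ n) ↔ (∀ a ∈ w₂, 1 ≤ a ∧ a ≤ n)) ∧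
    ((∀ a ∈ w₁, 1 ≤ a ∧ a ≤ n) → ∀ R, Valid n R → insertWord n R w₁ = insertWord n R w₂) := by
  rcases h with ⟨u, v, x, y, z, h1, h2, rfl, rfl⟩ | ⟨u, v, x, y, z, h1, h2, rfl, rfl⟩
  · refine ⟨?_, ?_⟩
    · have : ∀ a, a ∈ u ++ y :: x :: z :: v ↔ a ∈ u ++ y :: z :: x :: v := by
        intro a; simp; tauto
      simp only [this]
    · intro h R hR
      have hu := insertWord_valid u R hR (fun a ha => h a (by simp [ha]))
      have hx := h x (by simp)
      have hz := h z (by simp)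
      simp only [insertWord_append, insertWord_cons]
      rw [knuth1 hu hx.1 h1 h2 hz.2]
  · refine ⟨?_, ?_⟩
    · have : ∀ a, a ∈ u ++ x :: z :: y :: v ↔ a ∈ u ++ z :: x :: y :: v := by
        intro a; simp; tauto
      simp only [this]
    · intro h R hR
      have hu := insertWord_valid u R hR (fun a ha => h a (by simp [ha]))
      have hx := h x (by simp)
      have hz := h z (by simp)
      simp only [insertWord_append, insertWord_cons]
      rw [knuth2 hu hx.1 h1 h2 hz.2]

lemma knuth_equiv {n : ℕ} {w₁ w₂ : List ℕ} (h : KnuthEquiv w₁ w₂) :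
    ((∀ a ∈ w₁, 1 ≤ a ∧ a ≤ n) ↔ (∀ a ∈ w₂, 1 ≤ a ∧ a ≤ n)) ∧
    ((∀ a ∈ w₁, 1 ≤ a ∧ a ≤ n) → ∀ R, Valid n R → insertWord n R w₁ = insertWord n R w₂) := by
  induction h with
  | rel _ _ h => exact knuth_move h
  | refl => exact ⟨Iff.rfl, fun _ _ _ => rfl⟩
  | symm _ _ _ ih => exact ⟨ih.1.symm, fun h R hR => (ih.2 (ih.1.2 h) R hR).symm⟩
  | trans _ _ _ _ _ ih1 ih2 =>
    exact ⟨ih1.1.trans ih2.1, fun h R hR => (ih1.2 h R hR).trans (ih2.2 (ih1.1.1 h) R hR)⟩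

/-- Knuth equivalent words insert equally into any rc-graph
satisfying (*). -/
theorem insert_knuth_invariant (n : ℕ) (hn : 0 < n) (v₁ v₂ : List ℕ)
    (hv₁ : ∀ a ∈ v₁, 1 ≤ a ∧ a ≤ n) (hv₂ : ∀ a ∈ v₂, 1 ≤ a ∧ a ≤ n)
    (hK : KnuthEquiv v₁ v₂) (R : Finset (ℤ × ℤ)) (hR : IsRC n R) (hS : Star n R) :
    insertWord n R v₁ = insertWord n R v₂ := by
  exact (knuth_equiv hK).2 hv₁ R (valid_of hR hS)

end RCGraphs
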